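/- arXiv:2306.06685 — 11 statements merged into one kernel-verified Lean document; each statement's English description precedes it below -/
import Mathlib

section
/- Let ν ∈ [0,1] and set α = (1-2ν)². Then for all real numbers a, b > 0: (a^ν b^{1-ν} + a^{1-ν} b^ν)/2 ≤ (1-α)·√(ab) + α·(a+b)/2. -/
lemma cosh_aux (t x : ℝ) (ht : t ^ 2 ≤ 1) :
    Real.cosh (t * x) ≤ (1 - t ^ 2) + t ^ 2 * Real.cosh x := by
  have h1 := Real.hasSum_cosh (t * x)
  have h2 := (Real.hasSum_cosh x).mul_left (t ^ 2)
  have h3 : HasSum (fun n : ℕ => if n = 0 then (1 - t ^ 2) else 0) (1 - t ^ 2) :=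
    hasSum_ite_eq 0 (1 - t ^ 2)
  refine hasSum_le ?_ h1 (h3.add h2)
  intro n
  rcases n with _ | n
  · simp
  · have h4 : (t ^ 2) ^ n ≤ 1 := pow_le_one₀ (sq_nonneg t) ht
    have h5 : 0 ≤ x ^ (2 * (n + 1)) := by rw [pow_mul]; positivity
    have h6 : (t * x) ^ (2 * (n + 1)) ≤ t ^ 2 * x ^ (2 * (n + 1)) := by
      rw [mul_pow]
      apply mul_le_mul_of_nonneg_right _ h5
      rw [pow_mul, pow_succ]
      nlinarith [sq_nonneg t]
    simp only [Nat.add_eq_zero_iff, one_ne_zero, and_false, if_false, zero_add]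
    rw [← mul_div_assoc]
    gcongr

/-- Scalar Heinz–Heron inequality (2.00): for `ν ∈ [0,1]`, `α = (1-2ν)²`, and `a, b > 0`,
`(a^ν b^(1-ν) + a^(1-ν) b^ν)/2 ≤ (1-α)√(ab) + α(a+b)/2`. -/
theorem stmt_5 (ν : ℝ) (hν : ν ∈ Set.Icc (0 : ℝ) 1) (α : ℝ) (hα : α = (1 - 2 * ν) ^ 2)
    (a b : ℝ) (ha : 0 < a) (hb : 0 < b) :
    (a ^ ν * b ^ (1 - ν) + a ^ (1 - ν) * b ^ ν) / 2 ≤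
      (1 - α) * Real.sqrt (a * b) + α * ((a + b) / 2) := by
  obtain ⟨h0, h1⟩ := hν
  subst hα
  obtain ⟨p, rfl⟩ : ∃ p, a = Real.exp p := ⟨Real.log a, (Real.exp_log ha).symm⟩
  obtain ⟨q, rfl⟩ : ∃ q, b = Real.exp q := ⟨Real.log b, (Real.exp_log hb).symm⟩
  have key := cosh_aux (1 - 2 * ν) ((p - q) / 2) (by nlinarith)
  have hs : Real.sqrt (Real.exp p * Real.exp q) = Real.exp ((p + q) / 2) := by
    rw [← Real.exp_add, Real.exp_half]
  have key2 := mul_le_mul_of_nonneg_left key (Real.exp_pos ((p + q) / 2)).le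
  rw [hs]
  simp only [← Real.exp_mul, ← Real.exp_add]
  have e1 : Real.exp (p * ν + q * (1 - ν))
      = Real.exp ((p + q) / 2) * Real.exp (-((1 - 2 * ν) * ((p - q) / 2))) := by
    rw [← Real.exp_add]; congr 1; ring
  have e2 : Real.exp (p * (1 - ν) + q * ν)
      = Real.exp ((p + q) / 2) * Real.exp ((1 - 2 * ν) * ((p - q) / 2)) := by
    rw [← Real.exp_add]; congr 1; ring
  have e3 : Real.exp p = Real.exp ((p + q) / 2) * Real.exp ((p - q) / 2) := by
    rw [← Real.exp_add]; congr 1; ring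
  have e4 : Real.exp q = Real.exp ((p + q) / 2) * Real.exp (-((p - q) / 2)) := by
    rw [← Real.exp_add]; congr 1; ring
  rw [Real.cosh_eq, Real.cosh_eq] at key2
  rw [e1, e2, e3, e4]
  linarith
end

section
/- Let ν be a real number with ν ∉ (0,1) and set α = (1-2ν)². Then for all real numbers a, b > 0: (a^ν b^{1-ν} + a^{1-ν} b^ν)/2 ≥ (1-α)·√(ab) + α·(a+b)/2. -/
lemma heinz_aux (t x : ℝ) (ht : 1 ≤ t ^ 2) :
    (1 - t ^ 2) + t ^ 2 * Real.cosh x ≤ Real.cosh (t * x) := by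
  have h1 := (hasSum_ite_eq (0 : ℕ) (1 - t ^ 2)).add ((Real.hasSum_cosh x).mul_left (t ^ 2))
  refine hasSum_le (fun n => ?_) h1 (Real.hasSum_cosh (t * x))
  rcases n with _ | n
  · simp
  · have h2 : t ^ 2 ≤ (t ^ 2) ^ (n + 1) := le_self_pow₀ ht (by omega)
    have h3 : 0 ≤ x ^ (2 * (n + 1)) / ((2 * (n + 1)).factorial : ℝ) := by
      rw [pow_mul]; positivity
    have h4 := mul_le_mul_of_nonneg_right h2 h3
    rw [mul_pow, pow_mul t, mul_div_assoc]
    simpa using h4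

/-- Reversed scalar Heinz–Heron inequality (2.0): for `ν ∉ (0,1)`, `α = (1-2ν)²`, and `a, b > 0`,
`(a^ν b^(1-ν) + a^(1-ν) b^ν)/2 ≥ (1-α)√(ab) + α(a+b)/2`. -/
theorem stmt_6 (ν : ℝ) (hν : ν ∉ Set.Ioo (0 : ℝ) 1) (α : ℝ) (hα : α = (1 - 2 * ν) ^ 2)
    (a b : ℝ) (ha : 0 < a) (hb : 0 < b) :
    (a ^ ν * b ^ (1 - ν) + a ^ (1 - ν) * b ^ ν) / 2 ≥
      (1 - α) * Real.sqrt (a * b) + α * ((a + b) / 2) := by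
  obtain ⟨x, rfl⟩ : ∃ x, a = Real.exp (2 * x) :=
    ⟨Real.log a / 2, by rw [mul_div_cancel₀ _ (two_ne_zero), Real.exp_log ha]⟩
  obtain ⟨y, rfl⟩ : ∃ y, b = Real.exp (2 * y) :=
    ⟨Real.log b / 2, by rw [mul_div_cancel₀ _ (two_ne_zero), Real.exp_log hb]⟩
  have ht : 1 ≤ (1 - 2 * ν) ^ 2 := by
    by_contra h
    apply hν
    constructor <;> nlinarith
  have key := mul_le_mul_of_nonneg_left (heinz_aux (1 - 2 * ν) (x - y) ht)
    (Real.exp_pos (x + y)).le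
  have hs : Real.sqrt (Real.exp (2 * x) * Real.exp (2 * y)) = Real.exp (x + y) := by
    rw [← Real.exp_add, show 2 * x + 2 * y = (x + y) + (x + y) by ring, Real.exp_add (x + y),
      Real.sqrt_mul_self (Real.exp_pos _).le]
  have hc : ∀ z, Real.exp (x + y) * Real.cosh z =
      (Real.exp (x + y + z) + Real.exp (x + y - z)) / 2 := by
    intro z
    rw [Real.cosh_eq, Real.exp_add (x + y) z, sub_eq_add_neg, Real.exp_add (x + y) (-z)]
    ring
  have h1 := hc (x - y)
  rw [show x + y + (x - y) = 2 * x by ring, show x + y - (x - y) = 2 * y by ring] at h1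
  rw [hc] at key
  rw [hs, ← Real.exp_mul, ← Real.exp_mul, ← Real.exp_mul, ← Real.exp_mul, ← Real.exp_add,
    ← Real.exp_add, hα, ← h1,
    show 2 * x * ν + 2 * y * (1 - ν) = x + y - (1 - 2 * ν) * (x - y) by ring,
    show 2 * x * (1 - ν) + 2 * y * ν = x + y + (1 - 2 * ν) * (x - y) by ring]
  linarith
end

section
/- Let 𝒜 be a unital C*-algebra, let A and B be positive invertible elements of 𝒜, let r ∈ [-1,0] ∪ [1,2], and let λ ∈ [0,1]. Then ((1-λ)A + λB)^r ≤ (1-λ)A^r + λB^r. -/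
open scoped NNReal

variable {𝒜 : Type*} [CStarAlgebra 𝒜] [PartialOrder 𝒜] [StarOrderedRing 𝒜]

/-- The `r`-weighted geometric mean of positive invertible elements of a unital C*-algebra:
`A♯ᵣB = A^(1/2) (A^(-1/2) B A^(-1/2))^r A^(1/2)`, real powers taken via the continuous
functional calculus. -/
noncomputable def sharp (A B : 𝒜) (r : ℝ) : 𝒜 :=
  CFC.rpow A (1 / 2 : ℝ) *
    CFC.rpow (CFC.rpow A (-(1 / 2) : ℝ) * B * CFC.rpow A (-(1 / 2) : ℝ)) r *
      CFC.rpow A (1 / 2 : ℝ)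

theorem aux_inverse_rpow (a : 𝒜) (ha : IsStrictlyPositive a) (p : ℝ) :
    Ring.inverse (a ^ p) = a ^ (-p) := by
  have hu : IsUnit (a ^ p) := (IsStrictlyPositive.rpow a p ha).isUnit
  calc Ring.inverse (a ^ p) = Ring.inverse (a ^ p) * (a ^ p * a ^ (-p)) := by
        rw [CFC.rpow_mul_rpow_neg p ha, mul_one]
    _ = a ^ (-p) := by rw [← mul_assoc, Ring.inverse_mul_cancel _ hu, one_mul]

/-- completing the square -/
theorem aux_square (X Y Z : 𝒜) (hX : IsSelfAdjoint X) (hY : IsStrictlyPositive Y) :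
    0 ≤ X * Ring.inverse Y * X - X * Z - star Z * X + star Z * Y * Z := by
  have h1 : 0 ≤ star (X - Y * Z) * Ring.inverse Y * (X - Y * Z) :=
    star_left_conjugate_nonneg hY.ringInverse.nonneg _
  have hl := Ring.inverse_mul_cancel _ hY.isUnit
  have hr := Ring.mul_inverse_cancel _ hY.isUnit
  have e : star (X - Y * Z) * Ring.inverse Y * (X - Y * Z)
      = X * Ring.inverse Y * X - X * (Ring.inverse Y * Y) * Z - star Z * (Y * Ring.inverse Y) * X
        + star Z * (Y * Ring.inverse Y) * Y * Z := by
    rw [star_sub, star_mul, hX.star_eq, hY.isSelfAdjoint.star_eq]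
    noncomm_ring
  rw [hl, hr] at e
  simp only [mul_one] at e
  rwa [e] at h1

/-- joint convexity of `(X, Y) ↦ X Y⁻¹ X` -/
theorem aux_joint (A B P Q : 𝒜) (hA : IsSelfAdjoint A) (hB : IsSelfAdjoint B)
    (hP : IsStrictlyPositive P) (hQ : IsStrictlyPositive Q) (a b : ℝ) (ha : 0 ≤ a) (hb : 0 ≤ b)
    (hY : IsStrictlyPositive (a • P + b • Q)) :
    (a • A + b • B) * Ring.inverse (a • P + b • Q) * (a • A + b • B) ≤
      a • (A * Ring.inverse P * A) + b • (B * Ring.inverse Q * B) := by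
  set Y := a • P + b • Q with hYd
  set C := a • A + b • B with hCd
  have hC : IsSelfAdjoint C := by
    rw [hCd, isSelfAdjoint_iff, star_add, star_smul, star_smul, hA.star_eq, hB.star_eq]; simp
  set Z := Ring.inverse Y * C with hZ
  have hsZ : star Z = C * Ring.inverse Y := by
    rw [hZ, star_mul, hC.star_eq, hY.ringInverse.isSelfAdjoint.star_eq]
  have h1 := smul_nonneg ha (aux_square A P Z hA hP)
  have h2 := smul_nonneg hb (aux_square B Q Z hB hQ)
  have h3 := add_nonneg h1 h2
  have e1 : C * Z = C * Ring.inverse Y * C := by rw [hZ, mul_assoc]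
  have e2 : star Z * C = C * Ring.inverse Y * C := by rw [hsZ]
  have e3 : star Z * Y * Z = C * Ring.inverse Y * C := by
    rw [hsZ, mul_assoc C, Ring.inverse_mul_cancel _ hY.isUnit, mul_one, e1]
  have e : a • (A * Ring.inverse P * A - A * Z - star Z * A + star Z * P * Z)
      + b • (B * Ring.inverse Q * B - B * Z - star Z * B + star Z * Q * Z)
      = (a • (A * Ring.inverse P * A) + b • (B * Ring.inverse Q * B))
        - C * Z - star Z * C + star Z * Y * Z := by
    rw [hCd, hYd]
    simp only [smul_add, smul_sub, add_mul, mul_add, smul_mul_assoc, mul_smul_comm]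
    abel
  rw [e, e1, e2, e3, sub_add_cancel] at h3
  exact sub_nonneg.mp h3

/-- Operator convexity of `x ↦ x^r` for `r ∈ [-1,0] ∪ [1,2]` on a unital C*-algebra. -/
theorem stmt_7 (A B : 𝒜) (hA : 0 ≤ A) (hA' : IsUnit A) (hB : 0 ≤ B) (hB' : IsUnit B)
    (r : ℝ) (hr : r ∈ Set.Icc (-1 : ℝ) 0 ∪ Set.Icc (1 : ℝ) 2)
    (lam : ℝ) (hlam : lam ∈ Set.Icc (0 : ℝ) 1) :
    CFC.rpow ((1 - lam) • A + lam • B) r ≤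
      (1 - lam) • CFC.rpow A r + lam • CFC.rpow B r := by
  have sA : IsStrictlyPositive A := hA'.isStrictlyPositive hA
  have sB : IsStrictlyPositive B := hB'.isStrictlyPositive hB
  have h0 : 0 ≤ 1 - lam := sub_nonneg.mpr hlam.2
  have hmix : ∀ P Q : 𝒜, IsStrictlyPositive P → IsStrictlyPositive Q →
      IsStrictlyPositive ((1 - lam) • P + lam • Q) := by
    intro P Q hP hQ
    rcases hlam.1.eq_or_lt with h | h
    · simpa [← h] using hP
    · exact IsStrictlyPositive.nonneg_add (smul_nonneg h0 hP.nonneg) (hQ.smul h)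
  have sC := hmix A B sA sB
  simp only [CFC.rpow_eq_pow]
  have conc : ∀ p ∈ Set.Icc (0 : ℝ) 1, (1 - lam) • A ^ p + lam • B ^ p ≤
      ((1 - lam) • A + lam • B) ^ p := fun p hp =>
    (CFC.concaveOn_rpow (A := 𝒜) hp).2 hA hB h0 hlam.1 (by ring)
  have key : ∀ p ∈ Set.Icc (0 : ℝ) 1, ((1 - lam) • A + lam • B) ^ (-p) ≤
      Ring.inverse ((1 - lam) • A ^ p + lam • B ^ p) := fun p hp => by
    rw [← aux_inverse_rpow _ sC]
    exact CStarAlgebra.ringInverse_le_ringInverse (conc p hp)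
      (hmix _ _ (IsStrictlyPositive.rpow A p sA) (IsStrictlyPositive.rpow B p sB))
  rcases hr with hr | hr
  · have hp : -r ∈ Set.Icc (0 : ℝ) 1 := ⟨by linarith [hr.2], by linarith [hr.1]⟩
    have h1 := key (-r) hp
    have h2 := (CStarAlgebra.convexOn_ringInverse (A := 𝒜)).2
      (IsStrictlyPositive.rpow A (-r) sA) (IsStrictlyPositive.rpow B (-r) sB) h0 hlam.1 (by ring)
    have h3 := h1.trans h2
    rwa [aux_inverse_rpow _ sA, aux_inverse_rpow _ sB, neg_neg] at h3
  · have hp : 2 - r ∈ Set.Icc (0 : ℝ) 1 := ⟨by linarith [hr.2], by linarith [hr.1]⟩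
    have split : ∀ X : 𝒜, IsStrictlyPositive X → X * X ^ (-(2 - r)) * X = X ^ r := by
      intro X hX
      have e : r = 1 + -(2 - r) + 1 := by ring
      conv_rhs => rw [e, CFC.rpow_add hX.isUnit, CFC.rpow_add hX.isUnit, CFC.rpow_one X hX.nonneg]
    have sP := IsStrictlyPositive.rpow A (2 - r) sA
    have sQ := IsStrictlyPositive.rpow B (2 - r) sB
    have h1 := sC.isSelfAdjoint.conjugate_le_conjugate (key _ hp)
    have h2 := aux_joint A B _ _ sA.isSelfAdjoint sB.isSelfAdjoint sP sQ (1 - lam) lam h0 hlam.1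
      (hmix _ _ sP sQ)
    have h3 := h1.trans h2
    rwa [split _ sC, aux_inverse_rpow _ sA, aux_inverse_rpow _ sB, split _ sA, split _ sB] at h3
end

section
/- Let 𝒜 be a unital C*-algebra, let A and B be positive invertible elements of 𝒜, and let r ∈ (1,2). Then A♯_r B = ∫₀¹ (sin((r-1)π)/π) · s^{r-2} (1-s)^{1-r} · ((1-s)B^{-1} + s·B^{-1}AB^{-1})^{-1} ds, where the integral is a Bochner integral over (0,1). -/
open scoped NNReal

variable {𝒜 : Type*} [CStarAlgebra 𝒜] [PartialOrder 𝒜] [StarOrderedRing 𝒜]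

open MeasureTheory Set in
lemma beta_int {r : ℝ} (hr : r ∈ Ioo (1 : ℝ) 2) :
    IntegrableOn (fun s : ℝ => s ^ (r - 2) * (1 - s) ^ (1 - r)) (Ioo 0 1) ∧
    ∫ s in Ioo (0 : ℝ) 1, s ^ (r - 2) * (1 - s) ^ (1 - r) =
      Real.pi / Real.sin (Real.pi * (r - 1)) := by
  obtain ⟨h1, h2⟩ := hr
  have hc := Complex.betaIntegral_convergent (u := ((r - 1 : ℝ) : ℂ)) (v := ((2 - r : ℝ) : ℂ))
    (by rw [Complex.ofReal_re]; linarith) (by rw [Complex.ofReal_re]; linarith)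
  rw [intervalIntegrable_iff_integrableOn_Ioc_of_le (by simp)] at hc
  have heq : ∀ x ∈ Ioc (0 : ℝ) 1, RCLike.re ((x : ℂ) ^ (((r - 1 : ℝ) : ℂ) - 1) *
      (1 - (x : ℂ)) ^ (((2 - r : ℝ) : ℂ) - 1)) = x ^ (r - 2) * (1 - x) ^ (1 - r) := by
    intro x hx
    have e1 : ((r - 1 : ℝ) : ℂ) - 1 = ((r - 2 : ℝ) : ℂ) := by push_cast; ring
    have e2 : ((2 - r : ℝ) : ℂ) - 1 = ((1 - r : ℝ) : ℂ) := by push_cast; ring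
    have e3 : (1 - (x : ℂ)) = ((1 - x : ℝ) : ℂ) := by push_cast; ring
    rw [e1, e2, e3, ← Complex.ofReal_cpow hx.1.le, ← Complex.ofReal_cpow (by linarith [hx.2]),
      ← Complex.ofReal_mul, RCLike.re_to_complex, Complex.ofReal_re]
  constructor
  · have := (hc.re).congr (ae_restrict_of_forall_mem measurableSet_Ioc heq)
    exact IntegrableOn.mono_set this Ioo_subset_Ioc_self
  · have hb := ProbabilityTheory.beta_eq_betaIntegralReal (r - 1) (2 - r) (by linarith) (by linarith)
    rw [Complex.betaIntegral, intervalIntegral.integral_of_le (by norm_num),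
      ← RCLike.re_to_complex, ← integral_re hc, setIntegral_congr_fun measurableSet_Ioc heq,
      integral_Ioc_eq_integral_Ioo] at hb
    rw [← hb, ProbabilityTheory.beta, ← Real.Gamma_mul_Gamma_one_sub]
    have e4 : r - 1 + (2 - r) = 1 := by ring
    have e5 : 1 - (r - 1) = 2 - r := by ring
    rw [e4, e5, Real.Gamma_one, div_one]

open MeasureTheory Set in
lemma cov_int {r x : ℝ} (hx : 0 < x) :
    ∫ t in Ioi (0 : ℝ), Real.rpowIntegrand₁₂ r t x =
    ∫ s in Ioo (0 : ℝ) 1, s ^ (r - 2) * (1 - s) ^ (1 - r) *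
      ((1 - s) * x⁻¹ + s * (x⁻¹ * x⁻¹))⁻¹ := by
  have himg : (fun s : ℝ => s / (1 - s)) '' Ioo 0 1 = Ioi 0 := by
    ext t
    simp only [mem_image, mem_Ioo, mem_Ioi]
    constructor
    · rintro ⟨s, ⟨h0, h1⟩, rfl⟩
      exact div_pos h0 (by linarith)
    · intro ht
      refine ⟨t / (1 + t), ⟨by positivity, ?_⟩, ?_⟩
      · rw [div_lt_one (by positivity)]; linarith
      · field_simp; ring
  have hd : ∀ s ∈ Ioo (0 : ℝ) 1, HasDerivWithinAt (fun s : ℝ => s / (1 - s))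
      (1 / (1 - s) ^ 2) (Ioo 0 1) s := by
    intro s hs
    have h1 : (1 : ℝ) - s ≠ 0 := by linarith [hs.2]
    have := ((hasDerivAt_id s).div ((hasDerivAt_id s).const_sub 1) h1).hasDerivWithinAt
      (s := Ioo (0 : ℝ) 1)
    refine this.congr_deriv ?_
    simp
  have hinj : InjOn (fun s : ℝ => s / (1 - s)) (Ioo 0 1) := by
    intro a ha b hb hab
    have h1 : (1 : ℝ) - a ≠ 0 := by linarith [ha.2]
    have h2 : (1 : ℝ) - b ≠ 0 := by linarith [hb.2]
    simp only at hab
    rw [div_eq_div_iff h1 h2] at hab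
    linarith
  rw [← himg, integral_image_eq_integral_abs_deriv_smul measurableSet_Ioo hd hinj]
  refine setIntegral_congr_fun measurableSet_Ioo fun s hs => ?_
  obtain ⟨h0, h1⟩ := hs
  have h1' : 0 < 1 - s := by linarith
  simp only [Real.rpowIntegrand₁₂, smul_eq_mul]
  rw [abs_of_pos (by positivity), Real.div_rpow h0.le h1'.le,
    show r - 2 = (r - 1) - 1 by ring, Real.rpow_sub_one h0.ne' (r - 1), show 1 - r = - (r - 1) by ring,
    Real.rpow_neg h1'.le]
  generalize s ^ (r - 1) = u
  have : (1 - s) ^ (r - 1) ≠ 0 := (Real.rpow_pos_of_pos h1' _).ne'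
  generalize (1 - s) ^ (r - 1) = v at this
  have h3 : s / (1 - s) + x = (s + x * (1 - s)) / (1 - s) := by field_simp
  have h4 : (1 - s) * x⁻¹ + s * (x⁻¹ * x⁻¹) = (s + x * (1 - s)) / x ^ 2 := by field_simp; ring
  have h5 : 0 < s + x * (1 - s) := by positivity
  rw [h3, h4]
  generalize hw : s + x * (1 - s) = w at h5
  have h6 := h1'.ne'
  field_simp
  subst hw
  ring

/-- The weight in the integral representation. -/
noncomputable def wt (r s : ℝ) : ℝ :=
  Real.sin ((r - 1) * Real.pi) / Real.pi * s ^ (r - 2) * (1 - s) ^ (1 - r)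

open MeasureTheory Set in
lemma scalar_rep {r x : ℝ} (hr : r ∈ Ioo (1 : ℝ) 2) (hx : 0 < x) :
    x ^ r = ∫ s in Ioo (0 : ℝ) 1, wt r s * ((1 - s) * x⁻¹ + s * (x⁻¹ * x⁻¹))⁻¹ := by
  have hc : ∫ t in Ioi (0 : ℝ), Real.rpowIntegrand₀₁ (r - 1) t 1 =
      Real.pi / Real.sin (Real.pi * (r - 1)) := by
    rw [← (beta_int hr).2]
    have := cov_int (r := r) (x := 1) one_pos
    simp only [inv_one, mul_one, sub_add_cancel] at this
    rw [← this]
    refine setIntegral_congr_fun measurableSet_Ioi fun t ht => ?_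
    simp [Real.rpowIntegrand₁₂_eq_mul_rpowIntegrand₀₁ zero_le_one ht]
  rw [Real.rpow_eq_const_mul_integral_rpowIntegrand₁₂ hr hx.le, hc, cov_int hx,
    ← integral_const_mul]
  congr 1
  ext s
  rw [wt, inv_div, mul_comm Real.pi]
  ring

open MeasureTheory Set in
lemma op_rep (C : 𝒜) (hC : IsStrictlyPositive C) {r : ℝ} (hr : r ∈ Ioo (1 : ℝ) 2) :
    IntegrableOn (fun s : ℝ => wt r s •
      Ring.inverse ((1 - s) • Ring.inverse C + s • (Ring.inverse C * Ring.inverse C)))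
      (Ioo 0 1) ∧
    C ^ r = ∫ s in Ioo (0 : ℝ) 1, wt r s •
      Ring.inverse ((1 - s) • Ring.inverse C + s • (Ring.inverse C * Ring.inverse C)) := by
  have hpos : ∀ x ∈ spectrum ℝ C, 0 < x := fun x hx => hC.spectrum_pos hx
  have hsa : IsSelfAdjoint C := hC.isSelfAdjoint
  set f : ℝ → ℝ → ℝ := fun s x => wt r s * ((1 - s) * x⁻¹ + s * (x⁻¹ * x⁻¹))⁻¹ with hf
  have hden : ∀ s ∈ Ioo (0 : ℝ) 1, ∀ x : ℝ, 0 < x → 0 < (1 - s) * x⁻¹ + s * (x⁻¹ * x⁻¹) := by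
    intro s hs x hx
    have : 0 < 1 - s := by linarith [hs.2]
    have := hs.1
    positivity
  have hcinv : ContinuousOn (fun x : ℝ => x⁻¹) (spectrum ℝ C) :=
    continuousOn_inv₀.mono fun x hx => (hpos x hx).ne'
  have hfc : ∀ s ∈ Ioo (0 : ℝ) 1, cfc (f s) C = wt r s •
      Ring.inverse ((1 - s) • Ring.inverse C + s • (Ring.inverse C * Ring.inverse C)) := by
    intro s hs
    have hinv : cfc (fun x : ℝ => x⁻¹) C = Ring.inverse C := by
      have := cfc_inv_id (R := ℝ) hC.isUnit.unit (by simpa using hsa)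
      rw [← Ring.inverse_unit] at this
      simpa using this
    have hg : ContinuousOn (fun x : ℝ => (1 - s) * x⁻¹ + s * (x⁻¹ * x⁻¹)) (spectrum ℝ C) := by
      fun_prop
    have hne : ∀ x ∈ spectrum ℝ C, (1 - s) * x⁻¹ + s * (x⁻¹ * x⁻¹) ≠ 0 :=
      fun x hx => (hden s hs x (hpos x hx)).ne'
    have hgi : ContinuousOn (fun x : ℝ => ((1 - s) * x⁻¹ + s * (x⁻¹ * x⁻¹))⁻¹) (spectrum ℝ C) :=
      hg.inv₀ hne
    rw [hf]
    simp only
    rw [cfc_const_mul _ _ C hgi, cfc_inv _ C hne hg,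
      cfc_add C (fun x : ℝ => (1 - s) * x⁻¹) (fun x : ℝ => s * (x⁻¹ * x⁻¹)) (by fun_prop)
        (by fun_prop),
      cfc_const_mul _ _ C hcinv, cfc_const_mul _ _ C (by fun_prop), cfc_mul _ _ C hcinv hcinv,
      hinv]
  set K : ℝ := ‖C‖ + ‖C‖ ^ 2 with hK
  have hcont : ContinuousOn (Function.uncurry f) (Ioo 0 1 ×ˢ spectrum ℝ C) := by
    simp only [hf, wt, Function.uncurry_def]
    have i2 : ContinuousOn (fun q : ℝ × ℝ => q.2⁻¹) (Ioo 0 1 ×ˢ spectrum ℝ C) :=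
      ContinuousOn.inv₀ (by fun_prop) fun q hq => (hpos _ hq.2).ne'
    refine ContinuousOn.mul (ContinuousOn.mul (ContinuousOn.mul (by fun_prop) ?_) ?_) ?_
    · exact ContinuousOn.rpow_const (by fun_prop) fun q hq => .inl hq.1.1.ne'
    · exact ContinuousOn.rpow_const (by fun_prop) fun q hq => .inl (by linarith [hq.1.2])
    · exact ContinuousOn.inv₀ (by fun_prop) fun q hq => (hden _ hq.1 _ (hpos _ hq.2)).ne'
  have hbint : IntegrableOn (fun s => ‖wt r s‖ * K) (Ioo 0 1) := by
    have : IntegrableOn (wt r) (Ioo 0 1) := by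
      refine ((beta_int hr).1.const_mul (Real.sin ((r - 1) * Real.pi) / Real.pi)).congr
        (.of_forall fun s => ?_)
      simp [wt, mul_assoc]
    exact this.norm.mul_const K
  have hbd : ∀ᵐ s ∂(volume.restrict (Ioo (0 : ℝ) 1)), ∀ z ∈ spectrum ℝ C,
      ‖f s z‖ ≤ ‖wt r s‖ * K := by
    refine ae_restrict_of_forall_mem measurableSet_Ioo fun s hs z hz => ?_
    have hz0 := hpos z hz
    have hzn : z ≤ ‖C‖ := by
      cases subsingleton_or_nontrivial 𝒜 with
      | inl h => simp [spectrum.of_subsingleton] at hz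
      | inr h => exact (le_abs_self z).trans (spectrum.norm_le_norm_of_mem hz)
    rw [hf]
    simp only
    rw [norm_mul]
    gcongr
    rw [Real.norm_of_nonneg (inv_nonneg.2 (hden s hs z hz0).le)]
    have h1 : 0 < 1 - s := by linarith [hs.2]
    have h0 := hs.1
    calc _ = z ^ 2 / ((1 - s) * z + s) := by
          have := hden s hs z hz0
          field_simp
      _ ≤ z + z ^ 2 := by
          rw [div_le_iff₀ (by positivity)]
          nlinarith [mul_pos h1 hz0, mul_pos h0 hz0, mul_pos (mul_pos h1 hz0) (mul_pos hz0 hz0)]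
      _ ≤ K := by rw [hK]; gcongr
  have hcongr : ∀ᵐ s ∂(volume.restrict (Ioo (0 : ℝ) 1)), cfc (f s) C = wt r s •
      Ring.inverse ((1 - s) • Ring.inverse C + s • (Ring.inverse C * Ring.inverse C)) :=
    ae_restrict_of_forall_mem measurableSet_Ioo hfc
  constructor
  · exact (integrableOn_cfc measurableSet_Ioo f _ C hcont hbd hbint.2 hsa).congr hcongr
  · rw [← integral_congr_ae hcongr, ← cfc_setIntegral measurableSet_Ioo f _ C hcont hbd hbint.2 hsa,
      CFC.rpow_eq_cfc_real hC.nonneg]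
    exact cfc_congr fun x hx => scalar_rep hr (hpos x hx)

lemma alg_id (P Q C A B : 𝒜) (hPQ : P * Q = 1) (hQP : Q * P = 1) (hPP : P * P = A)
    (hB : IsUnit B) (hC : C = Q * B * Q) (s : ℝ) :
    P * Ring.inverse ((1 - s) • Ring.inverse C + s • (Ring.inverse C * Ring.inverse C)) * P =
      Ring.inverse ((1 - s) • Ring.inverse B + s • (Ring.inverse B * A * Ring.inverse B)) := by
  obtain ⟨b, rfl⟩ := hB
  let p : 𝒜ˣ := ⟨P, Q, hPQ, hQP⟩
  have hp : (p : 𝒜) = P := rfl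
  have hq : ((p⁻¹ : 𝒜ˣ) : 𝒜) = Q := rfl
  have hCi : Ring.inverse C = P * ↑b⁻¹ * P := by
    rw [hC, ← hq, ← hp, ← Units.val_mul, ← Units.val_mul, Ring.inverse_unit]
    simp [mul_assoc]
  rw [hCi, Ring.inverse_unit]
  have hX : (1 - s) • (P * (↑b⁻¹ : 𝒜) * P) + s • (P * (↑b⁻¹ : 𝒜) * P * (P * (↑b⁻¹ : 𝒜) * P)) =
      P * ((1 - s) • (↑b⁻¹ : 𝒜) + s • ((↑b⁻¹ : 𝒜) * A * ↑b⁻¹)) * P := by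
    rw [← hPP]
    simp only [mul_add, add_mul, mul_smul_comm, smul_mul_assoc, mul_assoc]
  rw [hX, Ring.inverse_mul (.inr p.isUnit), Ring.inverse_mul (.inl p.isUnit), ← hp,
    Ring.inverse_unit]
  simp [mul_assoc]

/-- Theorem 2.5: integral representation of `A♯ᵣB` for `r ∈ (1,2)`. -/
theorem stmt_8 (A B : 𝒜) (hA : 0 ≤ A) (hA' : IsUnit A) (hB : 0 ≤ B) (hB' : IsUnit B)
    (r : ℝ) (hr : r ∈ Set.Ioo (1 : ℝ) 2) :
    sharp A B r = ∫ s in Set.Ioo (0 : ℝ) 1,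
      (Real.sin ((r - 1) * Real.pi) / Real.pi * s ^ (r - 2) * (1 - s) ^ (1 - r)) •
        Ring.inverse ((1 - s) • Ring.inverse B +
          s • (Ring.inverse B * A * Ring.inverse B)) := by
  have hAs : IsStrictlyPositive A := hA'.isStrictlyPositive hA
  have hBs : IsStrictlyPositive B := hB'.isStrictlyPositive hB
  have hPQ : A ^ (1 / 2 : ℝ) * A ^ (-(1 / 2) : ℝ) = 1 := CFC.rpow_mul_rpow_neg _ hAs
  have hQP : A ^ (-(1 / 2) : ℝ) * A ^ (1 / 2 : ℝ) = 1 := CFC.rpow_neg_mul_rpow _ hAs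
  have hPP : A ^ (1 / 2 : ℝ) * A ^ (1 / 2 : ℝ) = A := by
    rw [← CFC.rpow_add hA', add_halves, CFC.rpow_one A hA]
  have hQ0 : 0 ≤ A ^ (-(1 / 2) : ℝ) := CFC.rpow_nonneg
  have hQu : IsUnit (A ^ (-(1 / 2) : ℝ)) := hA'.cfcRpow _ hA
  unfold sharp
  simp only [CFC.rpow_eq_pow]
  set P := A ^ (1 / 2 : ℝ)
  set Q := A ^ (-(1 / 2) : ℝ)
  have hC : IsStrictlyPositive (Q * B * Q) := by
    refine ((hQu.mul hB').mul hQu).isStrictlyPositive ?_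
    exact IsSelfAdjoint.conjugate_nonneg hB hQ0.isSelfAdjoint
  obtain ⟨hi, he⟩ := op_rep (Q * B * Q) hC hr
  rw [he]
  let L : 𝒜 →L[ℝ] 𝒜 := (ContinuousLinearMap.mul ℝ 𝒜 P).comp ((ContinuousLinearMap.mul ℝ 𝒜).flip P)
  have hL : ∀ y, L y = P * y * P := fun y => by simp [L, mul_assoc]
  rw [← hL, ← L.integral_comp_comm hi]
  congr 1
  ext s
  rw [hL, ← alg_id P Q (Q * B * Q) A B hPQ hQP hPP hB' rfl s, wt, mul_smul_comm, smul_mul_assoc]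
end

section
/- Let 𝒜 be a unital C*-algebra, let A and B be positive invertible elements of 𝒜, and let r ∈ (1,2). Then A♯_r B = B·(A♯_{2-r} B)^{-1}·B. -/
open scoped NNReal

variable {𝒜 : Type*} [CStarAlgebra 𝒜] [PartialOrder 𝒜] [StarOrderedRing 𝒜]

/-- Proposition 2.7(i): for `r ∈ (1,2)`, `A♯ᵣB = B (A♯₂₋ᵣB)⁻¹ B`. -/
theorem stmt_10 (A B : 𝒜) (hA : 0 ≤ A) (hA' : IsUnit A) (hB : 0 ≤ B) (hB' : IsUnit B)
    (r : ℝ) (hr : r ∈ Set.Ioo (1 : ℝ) 2) :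
    sharp A B r = B * Ring.inverse (sharp A B (2 - r)) * B := by
  have hsA : IsStrictlyPositive A := IsStrictlyPositive.iff_of_unital.mpr ⟨hA, hA'⟩
  unfold sharp
  simp only [CFC.rpow_eq_pow]
  have hST : A ^ (1 / 2 : ℝ) * A ^ (-(1 / 2) : ℝ) = 1 := CFC.rpow_mul_rpow_neg _ hsA
  have hTS : A ^ (-(1 / 2) : ℝ) * A ^ (1 / 2 : ℝ) = 1 := CFC.rpow_neg_mul_rpow _ hsA
  have hT0 : 0 ≤ A ^ (-(1 / 2) : ℝ) := CFC.rpow_nonneg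
  generalize A ^ (1 / 2 : ℝ) = S at *
  generalize A ^ (-(1 / 2) : ℝ) = T at *
  have hTu : IsUnit T := ⟨⟨T, S, hTS, hST⟩, rfl⟩
  have hC0 : 0 ≤ T * B * T := by
    have h := star_left_conjugate_nonneg hB T
    rwa [(IsSelfAdjoint.of_nonneg hT0).star_eq] at h
  have hCu : IsUnit (T * B * T) := (hTu.mul hB').mul hTu
  have hBC : B = S * (T * B * T) * S := by
    calc B = (S * T) * B * (T * S) := by rw [hST, hTS, one_mul, mul_one]
      _ = _ := by simp only [mul_assoc]
  generalize T * B * T = C at *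
  have hsC : IsStrictlyPositive C := IsStrictlyPositive.iff_of_unital.mpr ⟨hC0, hCu⟩
  have h1 : C ^ (2 - r) * C ^ (-(2 - r)) = 1 := CFC.rpow_mul_rpow_neg _ hsC
  have h2 : C ^ (-(2 - r)) * C ^ (2 - r) = 1 := CFC.rpow_neg_mul_rpow _ hsC
  have h3 : C ^ r = C * C ^ (-(2 - r)) * C := by
    have e : C ^ r = C ^ (1 : ℝ) * C ^ (-(2 - r)) * C ^ (1 : ℝ) := by
      rw [← CFC.rpow_add hCu, ← CFC.rpow_add hCu]
      congr 1
      ring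
    rwa [CFC.rpow_one C hC0] at e
  generalize C ^ (2 - r) = D at *
  generalize C ^ (-(2 - r)) = E at *
  have hinv : Ring.inverse (S * D * S) = T * E * T := by
    have e1 : (S * D * S) * (T * E * T) = 1 := by
      calc _ = S * (D * ((S * T) * E)) * T := by simp only [mul_assoc]
        _ = 1 := by rw [hST, one_mul, h1, mul_one, hST]
    have e2 : (T * E * T) * (S * D * S) = 1 := by
      calc _ = T * (E * ((T * S) * D)) * S := by simp only [mul_assoc]
        _ = 1 := by rw [hTS, one_mul, h2, mul_one, hTS]
    exact Ring.inverse_unit ⟨S * D * S, T * E * T, e1, e2⟩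
  rw [hinv, h3, hBC]
  calc S * (C * E * C) * S = S * C * (1 * E * 1) * C * S := by
        rw [one_mul, mul_one]; simp only [mul_assoc]
    _ = S * C * ((S * T) * E * (T * S)) * C * S := by rw [hST, hTS]
    _ = _ := by simp only [mul_assoc]
end

section
/- Let 𝒜 be a unital C*-algebra, let A and B be positive invertible elements of 𝒜, and let r ∈ (-1,2). Then A♯_r B = B♯_{1-r} A. -/
open scoped NNReal

variable {𝒜 : Type*} [CStarAlgebra 𝒜] [PartialOrder 𝒜] [StarOrderedRing 𝒜]

theorem rpow_unitary_conj (u : unitary 𝒜) (P : 𝒜) (hP : IsStrictlyPositive P) (s : ℝ) :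
    (u * P * star (u : 𝒜)) ^ s = u * P ^ s * star (u : 𝒜) := by
  have hc : Continuous (Unitary.conjStarAlgAut ℝ 𝒜 u) := by
    have : (Unitary.conjStarAlgAut ℝ 𝒜 u : 𝒜 → 𝒜) = fun x => u * x * star (u : 𝒜) := by
      ext x; simp [Unitary.conjStarAlgAut_apply]
    rw [this]; fun_prop
  have h0 : 0 ≤ (u * P * star (u : 𝒜)) := star_right_conjugate_nonneg hP.nonneg _
  rw [CFC.rpow_eq_cfc_real hP.nonneg, CFC.rpow_eq_cfc_real h0]
  have hz : (0:ℝ) ∉ spectrum ℝ P := spectrum.zero_notMem ℝ hP.isUnit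
  have := StarAlgHomClass.map_cfc (R := ℝ) (S := ℝ) (Unitary.conjStarAlgAut ℝ 𝒜 u) (fun x : ℝ => x ^ s) P
    (by
      intro x hx
      exact (Real.continuousAt_rpow_const x s (Or.inl (fun h => hz (h ▸ hx)))).continuousWithinAt)
    hc (by cfc_tac) (by
      rw [Unitary.conjStarAlgAut_apply]
      exact IsSelfAdjoint.of_nonneg h0)
  simpa [Unitary.conjStarAlgAut_apply] using this.symm

/-- Proposition 2.7(iii): for `r ∈ (-1,2)`, `A♯ᵣB = B♯₁₋ᵣA`. -/
theorem stmt_12 (A B : 𝒜) (hA : 0 ≤ A) (hA' : IsUnit A) (hB : 0 ≤ B) (hB' : IsUnit B)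
    (r : ℝ) (hr : r ∈ Set.Ioo (-1 : ℝ) 2) :
    sharp A B r = sharp B A (1 - r) := by
  have sA : IsStrictlyPositive A := hA'.isStrictlyPositive hA
  have sB : IsStrictlyPositive B := hB'.isStrictlyPositive hB
  simp only [sharp, CFC.rpow_eq_pow]
  have haa : A ^ (1/2 : ℝ) * A ^ (1/2 : ℝ) = A := by
    rw [← CFC.rpow_add hA']; norm_num [CFC.rpow_one A hA]
  have hbb : B ^ (1/2 : ℝ) * B ^ (1/2 : ℝ) = B := by
    rw [← CFC.rpow_add hB']; norm_num [CFC.rpow_one B hB]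
  have h1 := CFC.rpow_mul_rpow_neg (1/2) sA
  have h2 := CFC.rpow_neg_mul_rpow (1/2) sA
  have h3 := CFC.rpow_mul_rpow_neg (1/2) sB
  have h4 := CFC.rpow_neg_mul_rpow (1/2) sB
  have ua : star (A ^ (-(1/2) : ℝ)) = A ^ (-(1/2) : ℝ) :=
    (IsSelfAdjoint.of_nonneg CFC.rpow_nonneg).star_eq
  have ub : star (B ^ (1/2 : ℝ)) = B ^ (1/2 : ℝ) :=
    (IsSelfAdjoint.of_nonneg CFC.rpow_nonneg).star_eq
  generalize A ^ (1/2 : ℝ) = a at *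
  generalize A ^ (-(1/2) : ℝ) = ai at *
  generalize B ^ (1/2 : ℝ) = b at *
  generalize B ^ (-(1/2) : ℝ) = bi at *
  obtain ⟨P, hPd⟩ : ∃ P, P = ai * B * ai := ⟨_, rfl⟩
  have hP0 : 0 ≤ P := by
    have := star_left_conjugate_nonneg hB ai
    rwa [ua, ← hPd] at this
  have Ua : IsUnit ai := ⟨⟨ai, a, h2, h1⟩, rfl⟩
  have hPu : IsUnit P := by rw [hPd]; exact (Ua.mul hB').mul Ua
  have sP : IsStrictlyPositive P := hPu.isStrictlyPositive hP0
  rw [← hPd]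
  have XX : (ai * b) * (b * ai) = P := by rw [hPd, ← hbb]; noncomm_ring
  have pm : P * P ^ (-1 : ℝ) = 1 := by
    have := CFC.rpow_mul_rpow_neg 1 sP
    rwa [CFC.rpow_one P hP0] at this
  have mp : P ^ (-1 : ℝ) * P = 1 := by
    have := CFC.rpow_neg_mul_rpow 1 sP
    rwa [CFC.rpow_one P hP0] at this
  have hh : P ^ (-(1/2) : ℝ) * P ^ (-(1/2) : ℝ) = P ^ (-1 : ℝ) := by
    rw [← CFC.rpow_add hPu]; norm_num
  have hPP : P ^ (1/2 : ℝ) * P ^ (1/2 : ℝ) = P := by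
    rw [← CFC.rpow_add hPu]; norm_num [CFC.rpow_one P hP0]
  have k1 := CFC.rpow_mul_rpow_neg (1/2) sP
  have k2 := CFC.rpow_neg_mul_rpow (1/2) sP
  have sp : star (P ^ (-(1/2) : ℝ)) = P ^ (-(1/2) : ℝ) :=
    (IsSelfAdjoint.of_nonneg CFC.rpow_nonneg).star_eq
  have hinv : (bi * a) * (ai * b) = 1 := by
    rw [mul_assoc, ← mul_assoc a, h1, one_mul, h4]
  have hinv2 : (b * ai) * (a * bi) = 1 := by
    rw [mul_assoc, ← mul_assoc ai, h2, one_mul, h3]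
  have e1 : (b * ai) * P ^ (-1 : ℝ) = bi * a := by
    calc _ = (bi * a) * (ai * b) * ((b * ai) * P ^ (-1 : ℝ)) := by rw [hinv, one_mul]
      _ = (bi * a) * (((ai * b) * (b * ai)) * P ^ (-1 : ℝ)) := by simp only [mul_assoc]
      _ = _ := by rw [XX, pm, mul_one]
  have e2 : P ^ (-1 : ℝ) * (ai * b) = a * bi := by
    calc _ = P ^ (-1 : ℝ) * (ai * b) * ((b * ai) * (a * bi)) := by rw [hinv2, mul_one]
      _ = (P ^ (-1 : ℝ) * ((ai * b) * (b * ai))) * (a * bi) := by simp only [mul_assoc]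
      _ = _ := by rw [XX, mp, one_mul]
  have sU : star (b * ai * P ^ (-(1/2) : ℝ)) = P ^ (-(1/2) : ℝ) * (ai * b) := by
    simp only [star_mul, ua, ub, sp]
  have hU : b * ai * P ^ (-(1/2) : ℝ) ∈ unitary 𝒜 := by
    rw [Unitary.mem_iff, sU]
    constructor
    · calc _ = P ^ (-(1/2) : ℝ) * ((ai * b) * (b * ai)) * P ^ (-(1/2) : ℝ) := by
            simp only [mul_assoc]
        _ = (P ^ (-(1/2) : ℝ) * P ^ (1/2 : ℝ)) * (P ^ (1/2 : ℝ) * P ^ (-(1/2) : ℝ)) := by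
            rw [XX]; nth_rw 2 [← hPP]; simp only [mul_assoc]
        _ = 1 := by rw [k1, k2, one_mul]
    · calc _ = (b * ai) * (P ^ (-(1/2) : ℝ) * P ^ (-(1/2) : ℝ)) * (ai * b) := by
            simp only [mul_assoc]
        _ = 1 := by rw [hh, mul_assoc, e2, hinv2]
  have sPi : IsStrictlyPositive (P ^ (-1 : ℝ)) := IsStrictlyPositive.rpow P (-1) sP
  have key := rpow_unitary_conj ⟨_, hU⟩ (P ^ (-1 : ℝ)) sPi (1 - r)
  simp only [sU] at key
  have q1 : b * ai * P ^ (-(1/2) : ℝ) * P ^ (-1 : ℝ) * (P ^ (-(1/2) : ℝ) * (ai * b))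
      = bi * A * bi := by
    have hc : P ^ (-(1/2) : ℝ) * P ^ (-1 : ℝ) * P ^ (-(1/2) : ℝ) = P ^ (-1 : ℝ) * P ^ (-1 : ℝ) := by
      simp only [← CFC.rpow_add hPu]; norm_num
    calc _ = b * ai * (P ^ (-(1/2) : ℝ) * P ^ (-1 : ℝ) * P ^ (-(1/2) : ℝ)) * (ai * b) := by
            simp only [mul_assoc]
      _ = (b * ai * P ^ (-1 : ℝ)) * (P ^ (-1 : ℝ) * (ai * b)) := by
            rw [hc]; simp only [mul_assoc]
      _ = _ := by rw [e1, e2, ← haa]; simp only [mul_assoc]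
  have q2 : (P ^ (-1 : ℝ)) ^ (1 - r) = P ^ (r - 1) := by
    rw [CFC.rpow_rpow P _ _ (by norm_num) sP]
    congr 1; ring
  rw [q1, q2] at key
  rw [key]
  have f1 : b = a * (ai * b) := by rw [← mul_assoc, h1, one_mul]
  have f2 : b = (b * ai) * a := by rw [mul_assoc, h2, mul_one]
  have fin : P * (P ^ (-(1/2) : ℝ) * P ^ (r - 1) * P ^ (-(1/2) : ℝ)) * P = P ^ r := by
    have : P ^ r = P ^ (1:ℝ) * (P ^ (-(1/2) : ℝ) * P ^ (r - 1) * P ^ (-(1/2) : ℝ)) * P ^ (1:ℝ) := by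
      simp only [← CFC.rpow_add hPu]; congr 1; ring
    rw [this, CFC.rpow_one P hP0]
  symm
  calc _ = (a * (ai * b)) * (b * ai * P ^ (-(1/2) : ℝ) * P ^ (r - 1) *
            (P ^ (-(1/2) : ℝ) * (ai * b))) * ((b * ai) * a) := by rw [← f1, ← f2]
    _ = a * (((ai * b) * (b * ai)) * (P ^ (-(1/2) : ℝ) * P ^ (r - 1) * P ^ (-(1/2) : ℝ)) *
          ((ai * b) * (b * ai))) * a := by simp only [mul_assoc]
    _ = _ := by rw [XX, fin]
end

section
/- Let 𝒜 be a unital C*-algebra, let r ∈ (-1,0) ∪ (1,2), and let λ ∈ [0,1]. Then for all positive invertible A, B₁, B₂ in 𝒜: A♯_r((1-λ)B₁ + λB₂) ≤ (1-λ)(A♯_r B₁) + λ(A♯_r B₂); and for all positive invertible A₁, A₂, B in 𝒜: ((1-λ)A₁ + λA₂)♯_r B ≤ (1-λ)(A₁♯_r B) + λ(A₂♯_r B). -/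
open scoped NNReal

variable {𝒜 : Type*} [CStarAlgebra 𝒜] [PartialOrder 𝒜] [StarOrderedRing 𝒜]

theorem aux_integrand {p t : ℝ} (ht : 0 < t) :
    ConvexOn ℝ (Set.Ici (0 : 𝒜)) (cfc (Real.rpowIntegrand₁₂ p t)) := by
  have h₁ : (Set.Ici (0 : 𝒜)).EqOn (cfc (Real.rpowIntegrand₁₂ p t))
      (fun x : 𝒜 => t ^ (p - 1) • ((t⁻¹ • x + t • Ring.inverse (algebraMap ℝ 𝒜 t + x))
        - algebraMap ℝ 𝒜 1)) := by
    intro x hx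
    have hx0 : (0 : 𝒜) ≤ x := hx
    have hsp : ∀ r ∈ spectrum ℝ x, t + r ≠ 0 := by grind
    have hg : ContinuousOn (fun z : ℝ => (t + z)⁻¹) (spectrum ℝ x) := by
      fun_prop (disch := grind -abstractProof)
    have hf : ContinuousOn (fun z : ℝ => t⁻¹ * z) (spectrum ℝ x) := by fun_prop
    have hg' : ContinuousOn (fun z : ℝ => t * (t + z)⁻¹) (spectrum ℝ x) := hg.const_mul t
    have hfg : ContinuousOn (fun z : ℝ => t⁻¹ * z + t * (t + z)⁻¹) (spectrum ℝ x) := hf.add hg'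
    have h1 : ContinuousOn (fun _ : ℝ => (1 : ℝ)) (spectrum ℝ x) := continuousOn_const
    have hid : ContinuousOn (fun z : ℝ => z) (spectrum ℝ x) := continuousOn_id
    have hsa : IsSelfAdjoint x := IsSelfAdjoint.of_nonneg hx0
    have e : Real.rpowIntegrand₁₂ p t
        = fun z => t ^ (p - 1) * ((t⁻¹ * z + t * (t + z)⁻¹) - 1) := by
      funext z
      simp only [Real.rpowIntegrand₁₂]
    have c1 := cfc_const_mul (t ^ (p - 1))
      (fun z : ℝ => (t⁻¹ * z + t * (t + z)⁻¹) - 1) x (hfg.sub h1)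
    have c2 := cfc_sub (fun z : ℝ => t⁻¹ * z + t * (t + z)⁻¹) (fun _ : ℝ => (1 : ℝ)) x hfg h1
    have c3 := cfc_add x (fun z : ℝ => t⁻¹ * z) (fun z : ℝ => t * (t + z)⁻¹) hf hg'
    have c4 := cfc_const_mul t⁻¹ (fun z : ℝ => z) x hid
    have c5 := cfc_const_mul t (fun z : ℝ => (t + z)⁻¹) x hg
    have c6 := cfc_inv (fun z : ℝ => t + z) x hsp (by fun_prop) hsa
    have c7 := cfc_const_add t (fun z : ℝ => z) x hid hsa
    have c8 := cfc_id' ℝ x hsa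
    have c9 := cfc_const (1 : ℝ) x hsa
    rw [e, c1, c2, c3, c4, c5, c6, c7, c8, c9]
  refine ConvexOn.congr ?_ h₁.symm
  refine ConvexOn.smul (by positivity) (ConvexOn.sub (ConvexOn.add ?_ ?_)
    (concaveOn_const _ (convex_Ici 0)))
  · exact ConvexOn.smul (by positivity) (convexOn_id (convex_Ici 0))
  · exact ConvexOn.smul (by positivity) <| CStarAlgebra.convexOn_ringInverse_algebraMap_add ht

theorem aux_convex12 {p : ℝ} (hp : p ∈ Set.Ioo (1 : ℝ) 2) :
    ConvexOn ℝ (Set.Ici (0 : 𝒜)) (fun a : 𝒜 => a ^ p) := by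
  let q : ℝ≥0 := ⟨p, by linarith [hp.1]⟩
  have hq : q ∈ Set.Ioo (1 : ℝ≥0) 2 := by
    constructor
    · exact_mod_cast hp.1
    · exact_mod_cast hp.2
  change ConvexOn ℝ (Set.Ici (0 : 𝒜)) (fun a : 𝒜 => a ^ (q : ℝ))
  simp_rw [← CFC.nnrpow_eq_rpow (zero_lt_one.trans hq.1)]
  obtain ⟨μ, hμ⟩ := CFC.exists_measure_nnrpow_eq_integral_cfcₙ_rpowIntegrand₁₂ 𝒜 hq
  have h₃' : (Set.Ici 0).EqOn (fun a : 𝒜 => a ^ q)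
      (fun a : 𝒜 => ∫ t in Set.Ioi 0, cfcₙ (Real.rpowIntegrand₁₂ q t) a ∂μ) :=
    fun a ha => (hμ a ha).2
  refine ConvexOn.congr ?_ h₃'.symm
  refine MeasureTheory.integral_convexOn_of_integrand_ae (convex_Ici _) ?_ fun a ha => (hμ a ha).1
  filter_upwards [MeasureTheory.ae_restrict_mem measurableSet_Ioi] with t ht
  have ht : 0 < t := ht
  refine ConvexOn.congr (aux_integrand (p := q) ht) ?_
  intro a ha
  have ha0 : (0 : 𝒜) ≤ a := ha
  have hp' : (q : ℝ) ∈ Set.Ioi (1 : ℝ) := hp.1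
  symm
  refine cfcₙ_eq_cfc ?_ (Real.rpowIntegrand₁₂_zero ht)
  have := Real.continuousOn_rpowIntegrand₁₂_uncurry hp' (quasispectrum ℝ a) (by grind)
  exact this.comp (f := fun z => (t, z)) (by fun_prop) (fun z hz => ⟨ht, hz⟩)

theorem aux_sp {A : 𝒜} (h : 0 ≤ A) (hu : IsUnit A) : IsStrictlyPositive A := by grind

theorem aux_comb {A B : 𝒜} (hA : IsStrictlyPositive A) (hB : IsStrictlyPositive B)
    {a b : ℝ} (ha : 0 ≤ a) (hb : 0 ≤ b) (hab : a + b = 1) : IsStrictlyPositive (a • A + b • B) :=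
  (CStarAlgebra.convexOn_ringInverse (A := 𝒜)).1 hA hB ha hb hab

theorem aux_convex_neg {p : ℝ} (hp : p ∈ Set.Ioo (-1 : ℝ) 0) {A B : 𝒜}
    (hA : IsStrictlyPositive A) (hB : IsStrictlyPositive B)
    {a b : ℝ} (ha : 0 ≤ a) (hb : 0 ≤ b) (hab : a + b = 1) :
    (a • A + b • B) ^ p ≤ a • A ^ p + b • B ^ p := by
  have hC := aux_comb hA hB ha hb hab
  have key : ∀ X : 𝒜, IsStrictlyPositive X → X ^ p = (X ^ (-p)) ^ (-1 : ℝ) := by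
    intro X hX
    rw [CFC.rpow_rpow X _ _ (by linarith [hp.2])]
    simp
  have hA' : IsStrictlyPositive (A ^ (-p)) := IsStrictlyPositive.rpow A _ hA
  have hB' : IsStrictlyPositive (B ^ (-p)) := IsStrictlyPositive.rpow B _ hB
  have hD := aux_comb hA' hB' ha hb hab
  have h1 := (CFC.concaveOn_rpow (A := 𝒜) (p := -p) ⟨by linarith [hp.2], by linarith [hp.1]⟩).2
    hA.nonneg hB.nonneg ha hb hab
  have h2 := (CStarAlgebra.convexOn_ringInverse (A := 𝒜)).2 hA' hB' ha hb hab
  rw [CFC.inverse_eq_rpow_neg_one hA', CFC.inverse_eq_rpow_neg_one hB',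
    CFC.inverse_eq_rpow_neg_one hD] at h2
  rw [key _ hA, key _ hB, key _ hC]
  exact (CStarAlgebra.rpow_neg_one_le_rpow_neg_one h1 hD).trans h2

theorem aux_convex {p : ℝ} (hp : p ∈ Set.Ioo (-1 : ℝ) 0 ∪ Set.Ioo (1 : ℝ) 2) {A B : 𝒜}
    (hA : IsStrictlyPositive A) (hB : IsStrictlyPositive B)
    {a b : ℝ} (ha : 0 ≤ a) (hb : 0 ≤ b) (hab : a + b = 1) :
    (a • A + b • B) ^ p ≤ a • A ^ p + b • B ^ p := by
  rcases hp with hp | hp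
  · exact aux_convex_neg hp hA hB ha hb hab
  · exact (aux_convex12 hp).2 hA.nonneg hB.nonneg ha hb hab

/-- Unitary conjugation commutes with real powers. -/
theorem aux_unitary (u : unitary 𝒜) {a : 𝒜} (ha : IsStrictlyPositive a) (s : ℝ) :
    ((u : 𝒜) * a * star (u : 𝒜)) ^ s = (u : 𝒜) * a ^ s * star (u : 𝒜) := by
  have h0 : 0 ∉ spectrum ℝ≥0 a := spectrum.zero_notMem _ ha.isUnit
  have hn : 0 ≤ (u : 𝒜) * a * star (u : 𝒜) := star_right_conjugate_nonneg ha.nonneg _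
  have hc : ContinuousOn (fun x : ℝ≥0 => x ^ s) (spectrum ℝ≥0 a) := by
    intro x hx
    have : x ≠ 0 := fun h => h0 (h ▸ hx)
    exact (NNReal.continuousAt_rpow_const (Or.inl this)).continuousWithinAt
  have hφ : Continuous (Unitary.conjStarAlgAut ℂ 𝒜 u) := by
    change Continuous (fun x : 𝒜 => (u : 𝒜) * x * star (u : 𝒜))
    fun_prop
  exact (StarAlgHomClass.map_cfc (S := ℂ) (Unitary.conjStarAlgAut ℂ 𝒜 u) (fun x : ℝ≥0 => x ^ s) a hc hφ
    ha.nonneg hn).symm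

theorem aux_intertwine {T : 𝒜} (hT : IsUnit T) (s : ℝ) :
    T * (star T * T) ^ s = (T * star T) ^ s * T := by
  set a := star T * T with hadef
  have ha : IsStrictlyPositive a :=
    CStarAlgebra.isStrictlyPositive_iff_eq_star_mul_self.2 ⟨T, hT, rfl⟩
  have hau := ha.isUnit
  have hsa : ∀ x : ℝ, star (a ^ x) = a ^ x := fun x =>
    (IsSelfAdjoint.of_nonneg CFC.rpow_nonneg).star_eq
  have h1 : a ^ (1 : ℝ) = a := CFC.rpow_one a ha.nonneg
  have hUu : IsUnit (T * a ^ (-(1/2) : ℝ)) := hT.mul (hau.cfcRpow _ ha.nonneg)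
  have hU1 : star (T * a ^ (-(1/2) : ℝ)) * (T * a ^ (-(1/2) : ℝ)) = 1 := by
    calc _ = a ^ (-(1/2) : ℝ) * a ^ (1 : ℝ) * a ^ (-(1/2) : ℝ) := by
          rw [star_mul, hsa, h1, hadef]; simp only [mul_assoc]
      _ = 1 := by
          rw [← CFC.rpow_add hau, ← CFC.rpow_add hau]
          norm_num
          exact CFC.rpow_zero a ha.nonneg
  have hU2 : (T * a ^ (-(1/2) : ℝ)) * star (T * a ^ (-(1/2) : ℝ)) = 1 :=
    by
      obtain ⟨v, hv⟩ := hUu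
      rw [← hv] at hU1 ⊢
      rw [Units.eq_inv_of_mul_eq_one_right hU1]
      simp
  let u : unitary 𝒜 := ⟨T * a ^ (-(1/2) : ℝ), Unitary.mem_iff.2 ⟨hU1, hU2⟩⟩
  have huT : (u : 𝒜) * a ^ (1/2 : ℝ) = T := by
    change T * a ^ (-(1/2) : ℝ) * a ^ (1/2 : ℝ) = T
    rw [mul_assoc, CFC.rpow_neg_mul_rpow _ ha, mul_one]
  have hb : (u : 𝒜) * a * star (u : 𝒜) = T * star T := by
    conv_rhs => rw [← huT, star_mul, hsa]
    conv_lhs => rw [← h1, show (1 : ℝ) = 1/2 + 1/2 by norm_num, CFC.rpow_add hau]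
    simp only [mul_assoc]
  have huu : star (u : 𝒜) * (u : 𝒜) = 1 := hU1
  rw [← hb, aux_unitary u ha]
  clear_value u
  rw [← huT]
  calc _ = (u : 𝒜) * (a ^ (1/2 : ℝ) * a ^ s) := mul_assoc _ _ _
    _ = (u : 𝒜) * (a ^ s * a ^ (1/2 : ℝ)) := by
      rw [← CFC.rpow_add hau, ← CFC.rpow_add hau, add_comm]
    _ = (u : 𝒜) * a ^ s * (star (u : 𝒜) * (u : 𝒜)) * a ^ (1/2 : ℝ) := by
      rw [huu, mul_one, mul_assoc]
    _ = _ := by simp only [mul_assoc]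

theorem aux_conj_sp {A B : 𝒜} (hA : IsStrictlyPositive A) (hB : IsStrictlyPositive B) (s : ℝ) :
    IsStrictlyPositive (A ^ s * B * A ^ s) := by
  have h := IsStrictlyPositive.rpow A s hA
  refine aux_sp ?_ ((h.isUnit.mul hB.isUnit).mul h.isUnit)
  exact conjugate_nonneg_of_nonneg hB.nonneg h.nonneg

theorem aux_symm {A B : 𝒜} (hA : IsStrictlyPositive A) (hB : IsStrictlyPositive B) (r : ℝ) :
    sharp A B r = sharp B A (1 - r) := by
  have hsa : ∀ (X : 𝒜) (x : ℝ), star (X ^ x) = X ^ x := fun X x =>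
    (IsSelfAdjoint.of_nonneg CFC.rpow_nonneg).star_eq
  have half : ∀ X : 𝒜, IsStrictlyPositive X → X ^ (1/2 : ℝ) * X ^ (1/2 : ℝ) = X := by
    intro X hX
    rw [← CFC.rpow_add hX.isUnit]
    norm_num
    exact CFC.rpow_one X hX.nonneg
  simp only [sharp, CFC.rpow_eq_pow]
  have hAp := CFC.rpow_mul_rpow_neg (1/2) hA
  have hAn := CFC.rpow_neg_mul_rpow (1/2) hA
  have hBp := CFC.rpow_mul_rpow_neg (1/2) hB
  have hBn := CFC.rpow_neg_mul_rpow (1/2) hB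
  have hAh := half A hA
  have hBh := half B hB
  set P := A ^ (1/2 : ℝ)
  set P' := A ^ (-(1/2) : ℝ)
  set Q := B ^ (1/2 : ℝ)
  set Q' := B ^ (-(1/2) : ℝ)
  have sP' : star P' = P' := hsa _ _
  have sQ : star Q = Q := hsa _ _
  have hT : IsUnit (Q * P') :=
    (IsStrictlyPositive.rpow B _ hB).isUnit.mul (IsStrictlyPositive.rpow A _ hA).isUnit
  have e1 : P' * B * P' = star (Q * P') * (Q * P') := by
    rw [star_mul, sP', sQ, ← hBh]; simp only [mul_assoc]
  have hb : IsStrictlyPositive ((Q * P') * star (Q * P')) :=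
    CStarAlgebra.isStrictlyPositive_iff_eq_mul_star_self.2 ⟨_, hT, rfl⟩
  have hc : IsStrictlyPositive (Q' * A * Q') := aux_conj_sp hB hA _
  have e2 : (Q * P') * star (Q * P') * (Q' * A * Q') = 1 := by
    rw [star_mul, sP', sQ, ← hAh]
    calc _ = Q * (P' * (P' * ((Q * Q') * P)) * P) * Q' := by simp only [mul_assoc]
      _ = 1 := by rw [hBp, one_mul, hAn, mul_one, hAn, mul_one, hBp]
  have e3 : Q' * A * Q' = ((Q * P') * star (Q * P')) ^ (-1 : ℝ) := by
    have h := CFC.rpow_neg_mul_rpow 1 hb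
    rw [CFC.rpow_one _ hb.nonneg] at h
    exact (left_inv_eq_right_inv h e2).symm
  have ha : IsStrictlyPositive (star (Q * P') * (Q * P')) :=
    CStarAlgebra.isStrictlyPositive_iff_eq_star_mul_self.2 ⟨_, hT, rfl⟩
  have e4 : (star (Q * P') * (Q * P')) ^ r
      = star (Q * P') * (((Q * P') * star (Q * P')) ^ (r - 1) * (Q * P')) := by
    rw [← aux_intertwine hT, ← mul_assoc (star (Q * P')) (Q * P')]
    conv_lhs => rw [show r = 1 + (r - 1) by ring, CFC.rpow_add ha.isUnit,
      CFC.rpow_one _ ha.nonneg]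
  rw [e3, CFC.rpow_rpow _ _ _ (by norm_num) hb, e1, e4,
    show (-1 : ℝ) * (1 - r) = r - 1 by ring]
  generalize ((Q * P') * star (Q * P')) ^ (r - 1) = Z
  rw [star_mul, sP', sQ]
  calc _ = (P * P') * Q * Z * Q * (P' * P) := by simp only [mul_assoc]
    _ = _ := by rw [hAp, hAn, one_mul, mul_one]

theorem aux_first {r : ℝ} (hr : r ∈ Set.Ioo (-1 : ℝ) 0 ∪ Set.Ioo (1 : ℝ) 2)
    {lam : ℝ} (hlam : lam ∈ Set.Icc (0 : ℝ) 1) {A B₁ B₂ : 𝒜}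
    (hA : IsStrictlyPositive A) (h1 : IsStrictlyPositive B₁) (h2 : IsStrictlyPositive B₂) :
    sharp A ((1 - lam) • B₁ + lam • B₂) r ≤
        (1 - lam) • sharp A B₁ r + lam • sharp A B₂ r := by
  simp only [sharp, CFC.rpow_eq_pow]
  have h := aux_convex hr (aux_conj_sp hA h1 (-(1/2))) (aux_conj_sp hA h2 (-(1/2)))
    (a := 1 - lam) (b := lam) (by linarith [hlam.2]) hlam.1 (by ring)
  have h' := conjugate_le_conjugate_of_nonneg h (CFC.rpow_nonneg (a := A) (y := 1/2))
  simpa only [mul_add, add_mul, mul_smul_comm, smul_mul_assoc] using h'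

/-- Proposition 2.7(vi): for `r ∈ (-1,0) ∪ (1,2)`, the weighted geometric mean `A♯ᵣB` is
separately operator convex in each of its two arguments. -/
theorem stmt_15 (r : ℝ) (hr : r ∈ Set.Ioo (-1 : ℝ) 0 ∪ Set.Ioo (1 : ℝ) 2)
    (lam : ℝ) (hlam : lam ∈ Set.Icc (0 : ℝ) 1) :
    (∀ A B₁ B₂ : 𝒜, 0 ≤ A → IsUnit A → 0 ≤ B₁ → IsUnit B₁ → 0 ≤ B₂ → IsUnit B₂ →
      sharp A ((1 - lam) • B₁ + lam • B₂) r ≤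
        (1 - lam) • sharp A B₁ r + lam • sharp A B₂ r) ∧
    (∀ A₁ A₂ B : 𝒜, 0 ≤ A₁ → IsUnit A₁ → 0 ≤ A₂ → IsUnit A₂ → 0 ≤ B → IsUnit B →
      sharp ((1 - lam) • A₁ + lam • A₂) B r ≤
        (1 - lam) • sharp A₁ B r + lam • sharp A₂ B r) := by
  refine ⟨fun A B₁ B₂ hA uA h1 u1 h2 u2 =>
    aux_first hr hlam (aux_sp hA uA) (aux_sp h1 u1) (aux_sp h2 u2), ?_⟩
  intro A₁ A₂ B h1 u1 h2 u2 hB uB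
  have s1 := aux_sp h1 u1
  have s2 := aux_sp h2 u2
  have sB := aux_sp hB uB
  have hr' : 1 - r ∈ Set.Ioo (-1 : ℝ) 0 ∪ Set.Ioo (1 : ℝ) 2 := by
    rcases hr with h | h
    · exact Or.inr ⟨by linarith [h.2], by linarith [h.1]⟩
    · exact Or.inl ⟨by linarith [h.2], by linarith [h.1]⟩
  rw [aux_symm s1 sB, aux_symm s2 sB, aux_symm (aux_comb s1 s2 (by linarith [hlam.2]) hlam.1
    (by ring)) sB]
  exact aux_first hr' hlam sB s1 s2
end

section
/- Let 𝒜 be a unital C*-algebra, let A and B be positive invertible elements of 𝒜, let r ∈ (-1,2), and let C be an invertible self-adjoint element of 𝒜. Then C(A♯_r B)C = (CAC)♯_r(CBC). -/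
open scoped NNReal

variable {𝒜 : Type*} [CStarAlgebra 𝒜] [PartialOrder 𝒜] [StarOrderedRing 𝒜]

/-- Real powers of positive invertible elements commute with unitary conjugation. -/
theorem rpow_conj_unitary (U X : 𝒜) (h1 : U * star U = 1) (h2 : star U * U = 1)
    (hX : 0 ≤ X) (hX' : IsUnit X) (r : ℝ) :
    CFC.rpow (U * X * star U) r = U * CFC.rpow X r * star U := by
  have hpos : 0 ≤ U * X * star U := star_right_conjugate_nonneg hX U
  let u : unitary 𝒜 := ⟨U, Unitary.mem_iff.2 ⟨h2, h1⟩⟩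
  have hc : Continuous (Unitary.conjStarAlgAut ℝ 𝒜 u) := by
    change Continuous (fun x : 𝒜 => U * x * star U)
    fun_prop
  have hs : ContinuousOn (fun x : ℝ≥0 => x ^ r) (spectrum ℝ≥0 X) := by
    intro x hx
    have : x ≠ 0 := by
      rintro rfl
      exact spectrum.zero_notMem ℝ≥0 hX' hx
    exact (NNReal.continuousAt_rpow_const (Or.inl this)).continuousWithinAt
  exact (StarAlgHomClass.map_cfc (S := ℝ) (Unitary.conjStarAlgAut ℝ 𝒜 u)
    (fun x : ℝ≥0 => x ^ r) X hs hc hX hpos).symm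

/-- Proposition 2.7(vii): for `r ∈ (-1,2)` and `C` invertible self-adjoint,
`C (A♯ᵣB) C = (CAC)♯ᵣ(CBC)`. -/
theorem stmt_16 (A B C : 𝒜) (hA : 0 ≤ A) (hA' : IsUnit A) (hB : 0 ≤ B) (hB' : IsUnit B)
    (hC : IsSelfAdjoint C) (hC' : IsUnit C) (r : ℝ) (hr : r ∈ Set.Ioo (-1 : ℝ) 2) :
    C * sharp A B r * C = sharp (C * A * C) (C * B * C) r := by
  have half : ∀ X : 𝒜, 0 ≤ X → IsUnit X →
      CFC.rpow X (1 / 2 : ℝ) * CFC.rpow X (1 / 2 : ℝ) = X ∧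
      CFC.rpow X (1 / 2 : ℝ) * CFC.rpow X (-(1 / 2) : ℝ) = 1 ∧
      CFC.rpow X (-(1 / 2) : ℝ) * CFC.rpow X (1 / 2 : ℝ) = 1 ∧
      star (CFC.rpow X (1 / 2 : ℝ)) = CFC.rpow X (1 / 2 : ℝ) ∧
      star (CFC.rpow X (-(1 / 2) : ℝ)) = CFC.rpow X (-(1 / 2) : ℝ) := by
    intro X hX hX'
    simp only [CFC.rpow_eq_pow]
    refine ⟨?_, ?_, ?_, ?_, ?_⟩
    · rw [← CFC.rpow_add hX']
      norm_num
      exact CFC.rpow_one X hX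
    · rw [← CFC.rpow_add hX', add_neg_cancel, CFC.rpow_zero X hX]
    · rw [← CFC.rpow_add hX', neg_add_cancel, CFC.rpow_zero X hX]
    · exact (IsSelfAdjoint.of_nonneg CFC.rpow_nonneg).star_eq
    · exact (IsSelfAdjoint.of_nonneg CFC.rpow_nonneg).star_eq
  have hD : 0 ≤ C * A * C := by
    simpa [hC.star_eq] using star_right_conjugate_nonneg hA C
  have hD' : IsUnit (C * A * C) := (hC'.mul hA').mul hC'
  obtain ⟨hh, hk, kh, sh, sk⟩ := half A hA hA'
  obtain ⟨HH, HK, KH, sH, sK⟩ := half _ hD hD'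
  unfold sharp
  generalize CFC.rpow (C * A * C) (1 / 2 : ℝ) = H at *
  generalize CFC.rpow (C * A * C) (-(1 / 2) : ℝ) = K at *
  generalize CFC.rpow A (1 / 2 : ℝ) = h at *
  generalize CFC.rpow A (-(1 / 2) : ℝ) = k at *
  have uh : IsUnit h := ⟨⟨h, k, hk, kh⟩, rfl⟩
  have uk : IsUnit k := ⟨⟨k, h, kh, hk⟩, rfl⟩
  have uK : IsUnit K := ⟨⟨K, H, KH, HK⟩, rfl⟩
  have sU : star (K * C * h) = h * C * K := by
    simp [star_mul, sK, sh, hC.star_eq, mul_assoc]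
  have h1 : (K * C * h) * star (K * C * h) = 1 := by
    calc _ = K * (C * (h * h) * C) * K := by rw [sU]; simp only [mul_assoc]
      _ = (K * H) * (H * K) := by rw [hh, ← HH]; simp only [mul_assoc]
      _ = 1 := by rw [KH, HK, one_mul]
  have h2 : star (K * C * h) * (K * C * h) = 1 := by
    obtain ⟨u, hu⟩ := (uK.mul hC').mul uh
    rw [← hu] at h1 ⊢
    have h3 : star (u : 𝒜) = ↑u⁻¹ := by
      rw [← one_mul (star (u : 𝒜)), ← u.inv_mul, mul_assoc, h1, mul_one]
    rw [h3, u.inv_mul]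
  have hX : 0 ≤ k * B * k := by
    simpa [sk] using star_right_conjugate_nonneg hB k
  have e := rpow_conj_unitary (K * C * h) (k * B * k) h1 h2 hX ((uk.mul hB').mul uk) r
  have e2 : (K * C * h) * (k * B * k) * star (K * C * h) = K * (C * B * C) * K := by
    calc _ = K * C * (h * k) * B * (k * h) * C * K := by rw [sU]; simp only [mul_assoc]
      _ = _ := by rw [hk, kh]; simp only [mul_assoc, one_mul, mul_one]
  rw [e2, sU] at e
  rw [e]
  generalize CFC.rpow (k * B * k) r = Y
  calc _ = 1 * (C * (h * Y * h) * C) * 1 := by simp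
    _ = (H * K) * (C * (h * Y * h) * C) * (K * H) := by rw [HK, KH]
    _ = _ := by simp only [mul_assoc]
end

section
/- Let 𝒜 be a unital C*-algebra, let A and B be positive invertible elements of 𝒜, and let r ∈ (-1,0) ∪ (1,2). Then (1-r)A + rB ≤ A♯_r B. If moreover every element λ of the spectrum of A^{-1/2}BA^{-1/2} satisfies (1-r) + r·λ^{-1} > 0, then also A♯_r B ≤ ((1-r)A^{-1} + rB^{-1})^{-1}. -/
open scoped NNReal

variable {𝒜 : Type*} [CStarAlgebra 𝒜] [PartialOrder 𝒜] [StarOrderedRing 𝒜]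

theorem inverse_eq_of_mul_eq_one_both {R : Type*} [Ring R] {x y : R}
    (h1 : x * y = 1) (h2 : y * x = 1) : Ring.inverse x = y :=
  Ring.inverse_unit (⟨x, y, h1, h2⟩ : Rˣ)

theorem young_scalar {x r : ℝ} (hx : 0 < x)
    (hr : r ∈ Set.Ioo (-1 : ℝ) 0 ∪ Set.Ioo (1 : ℝ) 2) : (1 - r) + r * x ≤ x ^ r := by
  rcases hr with hr | hr
  · have hi : 0 < x⁻¹ := inv_pos.2 hx
    have h := one_add_mul_self_le_rpow_one_add (s := x⁻¹ - 1) (p := 1 - r)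
      (by linarith) (by linarith [hr.2])
    rw [add_sub_cancel] at h
    have h2 := mul_le_mul_of_nonneg_left h hx.le
    have e : x * x⁻¹ ^ (1 - r) = x ^ r := by
      rw [Real.inv_rpow hx.le, ← Real.rpow_neg hx.le, neg_sub, Real.rpow_sub_one hx.ne']
      field_simp
    have e2 : x * (1 + (1 - r) * (x⁻¹ - 1)) = (1 - r) + r * x := by
      field_simp
      ring
    rw [e, e2] at h2
    exact h2
  · have h := one_add_mul_self_le_rpow_one_add (s := x - 1) (by linarith) hr.1.le
    rw [add_sub_cancel] at h
    linarith

/-- Theorem 2.8 (reverse Young inequality): for `r ∈ (-1,0) ∪ (1,2)`,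
`A∇ᵣB ≤ A♯ᵣB`, and under the spectral positivity hypothesis also `A♯ᵣB ≤ A!ᵣB`. -/
theorem stmt_17 (A B : 𝒜) (hA : 0 ≤ A) (hA' : IsUnit A) (hB : 0 ≤ B) (hB' : IsUnit B)
    (r : ℝ) (hr : r ∈ Set.Ioo (-1 : ℝ) 0 ∪ Set.Ioo (1 : ℝ) 2) :
    (1 - r) • A + r • B ≤ sharp A B r ∧
      ((∀ lam ∈ spectrum ℝ
          (CFC.rpow A (-(1 / 2) : ℝ) * B * CFC.rpow A (-(1 / 2) : ℝ)),
          0 < (1 - r) + r * lam⁻¹) →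
        sharp A B r ≤
          Ring.inverse ((1 - r) • Ring.inverse A + r • Ring.inverse B)) := by
  have hAp : IsStrictlyPositive A := hA'.isStrictlyPositive hA
  unfold sharp
  simp only [CFC.rpow_eq_pow]
  have h1 : A ^ (1 / 2 : ℝ) * A ^ (-(1 / 2) : ℝ) = 1 := CFC.rpow_mul_rpow_neg _
  have h2 : A ^ (-(1 / 2) : ℝ) * A ^ (1 / 2 : ℝ) = 1 := CFC.rpow_neg_mul_rpow _
  have h3 : A ^ (1 / 2 : ℝ) * A ^ (1 / 2 : ℝ) = A := by
    rw [← CFC.rpow_add hA']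
    norm_num
    exact CFC.rpow_one A
  have hS : 0 ≤ A ^ (1 / 2 : ℝ) := CFC.rpow_nonneg
  have hS' : 0 ≤ A ^ (-(1 / 2) : ℝ) := CFC.rpow_nonneg
  generalize A ^ (1 / 2 : ℝ) = S at *
  generalize A ^ (-(1 / 2) : ℝ) = S' at *
  have hC0 : 0 ≤ S' * B * S' := conjugate_nonneg_of_nonneg hB hS'
  have hSu' : IsUnit S' := ⟨⟨S', S, h2, h1⟩, rfl⟩
  have hCu : IsUnit (S' * B * S') := (hSu'.mul hB').mul hSu'
  have hBC : S * (S' * B * S') * S = B := by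
    calc S * (S' * B * S') * S = (S * S') * B * (S' * S) := by noncomm_ring
      _ = B := by rw [h1, h2, one_mul, mul_one]
  generalize S' * B * S' = C at *
  have hCp : IsStrictlyPositive C := hCu.isStrictlyPositive hC0
  have hpos : ∀ x ∈ spectrum ℝ C, 0 < x := fun x hx => hCp.spectrum_pos hx
  have hsa : IsSelfAdjoint C := .of_nonneg hC0
  have hcr : ContinuousOn (fun x : ℝ => x ^ r) (spectrum ℝ C) := fun x hx =>
    (Real.continuousAt_rpow_const x r (Or.inl (hpos x hx).ne')).continuousWithinAt
  have hci : ContinuousOn (fun x : ℝ => x⁻¹) (spectrum ℝ C) :=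
    continuousOn_inv₀.mono fun x hx => (hpos x hx).ne'
  rw [CFC.rpow_eq_cfc_real hC0]
  constructor
  · have key : (1 - r) • (1 : 𝒜) + r • C ≤ cfc (fun x : ℝ => x ^ r) C := by
      have e : cfc (fun x : ℝ => (1 - r) + r * x) C = (1 - r) • (1 : 𝒜) + r • C := by
        rw [cfc_const_add (1 - r) (fun x => r * x) C, cfc_const_mul_id r C,
          Algebra.algebraMap_eq_smul_one]
      rw [← e]
      exact cfc_mono (fun x hx => young_scalar (hpos x hx) hr) (by fun_prop) hcr
    have := conjugate_le_conjugate_of_nonneg key hS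
    simp only [mul_add, add_mul, mul_smul_comm, smul_mul_assoc, mul_one, hBC, h3] at this
    exact this
  · intro hlam
    have hcT : ContinuousOn (fun x : ℝ => (1 - r) + r * x⁻¹) (spectrum ℝ C) :=
      continuousOn_const.add (hci.const_mul r)
    have hcD : ContinuousOn (fun x : ℝ => ((1 - r) + r * x⁻¹)⁻¹) (spectrum ℝ C) :=
      hcT.inv₀ fun x hx => (hlam x hx).ne'
    have hle : cfc (fun x : ℝ => x ^ r) C ≤ cfc (fun x : ℝ => ((1 - r) + r * x⁻¹)⁻¹) C := by
      refine cfc_mono (fun x hx => ?_) hcr hcD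
      have hx0 := hpos x hx
      have := young_scalar (inv_pos.2 hx0) hr
      rw [Real.inv_rpow hx0.le] at this
      exact (le_inv_comm₀ (hlam x hx) (Real.rpow_pos_of_pos hx0 r)).1 this
    have hCI : C * cfc (fun x : ℝ => x⁻¹) C = 1 := by
      nth_rewrite 1 [← cfc_id' ℝ C]
      rw [← cfc_mul (fun x => x) _ C continuousOn_id hci, ← cfc_one ℝ C]
      exact cfc_congr fun x hx => mul_inv_cancel₀ (hpos x hx).ne'
    have hIC : cfc (fun x : ℝ => x⁻¹) C * C = 1 := by
      nth_rewrite 2 [← cfc_id' ℝ C]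
      rw [← cfc_mul _ (fun x => x) C hci continuousOn_id, ← cfc_one ℝ C]
      exact cfc_congr fun x hx => inv_mul_cancel₀ (hpos x hx).ne'
    have hT : cfc (fun x : ℝ => (1 - r) + r * x⁻¹) C
        = (1 - r) • (1 : 𝒜) + r • cfc (fun x : ℝ => x⁻¹) C := by
      rw [cfc_const_add (1 - r) (fun x => r * x⁻¹) C (hci.const_mul r), cfc_const_mul r (fun x => x⁻¹) C hci,
        Algebra.algebraMap_eq_smul_one]
    have hTD : cfc (fun x : ℝ => (1 - r) + r * x⁻¹) C
        * cfc (fun x : ℝ => ((1 - r) + r * x⁻¹)⁻¹) C = 1 := by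
      rw [← cfc_mul _ _ C hcT hcD, ← cfc_one ℝ C]
      exact cfc_congr fun x hx => mul_inv_cancel₀ (hlam x hx).ne'
    have hDT : cfc (fun x : ℝ => ((1 - r) + r * x⁻¹)⁻¹) C
        * cfc (fun x : ℝ => (1 - r) + r * x⁻¹) C = 1 := by
      rw [← cfc_mul _ _ C hcD hcT, ← cfc_one ℝ C]
      exact cfc_congr fun x hx => inv_mul_cancel₀ (hlam x hx).ne'
    have conj : ∀ X Y P Q : 𝒜, X * Y = 1 → P * Q = 1 → Q * P = 1 →
        (P * X * P) * (Q * Y * Q) = 1 := by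
      intro X Y P Q hXY hPQ hQP
      calc (P * X * P) * (Q * Y * Q) = P * X * (P * Q) * Y * Q := by noncomm_ring
        _ = P * (X * Y) * Q := by rw [hPQ]; noncomm_ring
        _ = 1 := by rw [hXY, mul_one, hPQ]
    have hAi : Ring.inverse A = S' * 1 * S' := by
      have e : A = S * 1 * S := by rw [mul_one, h3]
      rw [e]
      exact inverse_eq_of_mul_eq_one_both (conj _ _ _ _ (one_mul 1) h1 h2)
        (conj _ _ _ _ (one_mul 1) h2 h1)
    have hBi : Ring.inverse B = S' * cfc (fun x : ℝ => x⁻¹) C * S' := by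
      rw [← hBC]
      exact inverse_eq_of_mul_eq_one_both (conj _ _ _ _ hCI h1 h2) (conj _ _ _ _ hIC h2 h1)
    have hsum : (1 - r) • Ring.inverse A + r • Ring.inverse B
        = S' * cfc (fun x : ℝ => (1 - r) + r * x⁻¹) C * S' := by
      rw [hAi, hBi, hT]
      simp only [mul_add, add_mul, mul_smul_comm, smul_mul_assoc]
    rw [hsum, inverse_eq_of_mul_eq_one_both (conj _ _ _ _ hTD h2 h1) (conj _ _ _ _ hDT h1 h2)]
    exact conjugate_le_conjugate_of_nonneg hle hS
end

section
/- Let 𝒜 be a unital C*-algebra, let A and B be positive invertible elements of 𝒜, let ν ∈ [0,1], and set α = (1-2ν)². Then (A♯_ν B + A♯_{1-ν} B)/2 ≤ (1-α)·(A♯_{1/2} B) + α·(A+B)/2. If instead ν ∉ (0,1) (with ν ∈ (-1,2) so that the means are as in the paper), the reverse inequality (A♯_ν B + A♯_{1-ν} B)/2 ≥ (1-α)·(A♯_{1/2} B) + α·(A+B)/2 holds. -/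
open scoped NNReal

variable {𝒜 : Type*} [CStarAlgebra 𝒜] [PartialOrder 𝒜] [StarOrderedRing 𝒜]

/-- For `|s| ≤ 1`, `sinh (s u) ^ 2 ≤ s ^ 2 sinh u ^ 2`. -/
lemma aux_sinh {s u : ℝ} (hs0 : 0 ≤ s) (hs : s ≤ 1) (hu : 0 ≤ u) :
    Real.sinh (s * u) ≤ s * Real.sinh u := by
  have hd : ∀ x : ℝ, HasDerivAt (fun x : ℝ => s * Real.sinh x - Real.sinh (s * x))
      (s * Real.cosh x - Real.cosh (s * x) * s) x := by
    intro x
    have h1 : HasDerivAt (fun x : ℝ => s * x) s x := by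
      simpa using (hasDerivAt_id x).const_mul s
    exact ((Real.hasDerivAt_sinh x).const_mul s).sub h1.sinh
  have hm : MonotoneOn (fun x : ℝ => s * Real.sinh x - Real.sinh (s * x)) (Set.Ici 0) := by
    apply monotoneOn_of_deriv_nonneg (convex_Ici 0)
    · exact fun x _ => (hd x).continuousAt.continuousWithinAt
    · exact fun x _ => (hd x).differentiableAt.differentiableWithinAt
    · intro x hx
      rw [interior_Ici, Set.mem_Ioi] at hx
      rw [(hd x).deriv]
      have : Real.cosh (s * x) ≤ Real.cosh x := by
        rw [Real.cosh_le_cosh, abs_of_nonneg (by positivity), abs_of_pos hx]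
        nlinarith
      nlinarith
  have := hm (Set.mem_Ici.2 le_rfl) (Set.mem_Ici.2 hu) hu
  simp at this
  exact this

lemma aux_cosh {s : ℝ} (t : ℝ) (hs : |s| ≤ 1) :
    Real.cosh (s * t) - 1 ≤ s ^ 2 * (Real.cosh t - 1) := by
  have key : ∀ x : ℝ, Real.cosh x - 1 = 2 * Real.sinh (|x| / 2) ^ 2 := by
    intro x
    have h1 := Real.cosh_two_mul (|x| / 2)
    have h2 := Real.cosh_sq (|x| / 2)
    rw [show 2 * (|x| / 2) = |x| by ring, Real.cosh_abs] at h1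
    linarith
  rw [key, key, abs_mul, ← sq_abs s, mul_div_assoc]
  have h := aux_sinh (abs_nonneg s) hs (u := |t| / 2) (by positivity)
  have h0 : 0 ≤ Real.sinh (|s| * (|t| / 2)) := Real.sinh_nonneg_iff.2 (by positivity)
  nlinarith [pow_le_pow_left₀ h0 h 2]

lemma aux_param {x : ℝ} (hx : 0 < x) (ν : ℝ) :
    x ^ ν + x ^ (1 - ν) =
      2 * x ^ (1 / 2 : ℝ) * Real.cosh ((1 - 2 * ν) * (Real.log x / 2)) := by
  rw [Real.cosh_eq, Real.rpow_def_of_pos hx, Real.rpow_def_of_pos hx, Real.rpow_def_of_pos hx]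
  have e : ∀ a b c : ℝ, 2 * a * ((b + c) / 2) = a * c + a * b := by intros; ring
  rw [e, ← Real.exp_add, ← Real.exp_add]
  congr 2 <;> ring

lemma aux_le {x : ℝ} (hx : 0 < x) {ν : ℝ} (h : ν ∈ Set.Icc (0 : ℝ) 1) :
    2⁻¹ * (x ^ ν + x ^ (1 - ν)) ≤ (1 - (1 - 2 * ν) ^ 2) * x ^ (1 / 2 : ℝ)
      + (1 - 2 * ν) ^ 2 * (2⁻¹ * (1 + x)) := by
  have h1 := aux_param hx 0
  rw [Real.rpow_zero, sub_zero, Real.rpow_one] at h1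
  rw [aux_param hx ν, h1]
  have h2 := aux_cosh (s := 1 - 2 * ν) (Real.log x / 2)
    (abs_le.2 ⟨by linarith [h.2], by linarith [h.1]⟩)
  have h3 : 0 < x ^ (1 / 2 : ℝ) := by positivity
  have := mul_le_mul_of_nonneg_left h2 h3.le
  simp only [mul_zero, sub_zero, one_mul]
  nlinarith

lemma aux_ge {x : ℝ} (hx : 0 < x) {ν : ℝ} (h : ν ∉ Set.Ioo (0 : ℝ) 1) :
    (1 - (1 - 2 * ν) ^ 2) * x ^ (1 / 2 : ℝ)
      + (1 - 2 * ν) ^ 2 * (2⁻¹ * (1 + x)) ≤ 2⁻¹ * (x ^ ν + x ^ (1 - ν)) := by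
  have h1 := aux_param hx 0
  rw [Real.rpow_zero, sub_zero, Real.rpow_one] at h1
  rw [aux_param hx ν, h1]
  have hs : 1 ≤ |1 - 2 * ν| := by
    by_contra hc
    rw [not_le, abs_lt] at hc
    exact h ⟨by linarith [hc.2], by linarith [hc.1]⟩
  have hne : (1 - 2 * ν) ≠ 0 := by
    intro h0
    rw [h0] at hs
    norm_num at hs
  have h2 := aux_cosh (s := (1 - 2 * ν)⁻¹) ((1 - 2 * ν) * (Real.log x / 2))
    (by rw [abs_inv]; exact inv_le_one_of_one_le₀ hs)
  rw [inv_mul_cancel_left₀ hne] at h2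
  have h4 := mul_le_mul_of_nonneg_left h2 (sq_nonneg (1 - 2 * ν))
  rw [← mul_assoc, ← mul_pow, mul_inv_cancel₀ hne, one_pow, one_mul] at h4
  have h3 : 0 < x ^ (1 / 2 : ℝ) := by positivity
  have := mul_le_mul_of_nonneg_left h4 h3.le
  simp only [mul_zero, sub_zero, one_mul]
  nlinarith

lemma aux_cfc (X : 𝒜) (hX : 0 ≤ X) (hX' : IsUnit X) (ν α : ℝ) :
    (2⁻¹ : ℝ) • (X ^ ν + X ^ (1 - ν)) = cfc (fun x : ℝ => 2⁻¹ * (x ^ ν + x ^ (1 - ν))) X ∧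
    (1 - α) • X ^ (1 / 2 : ℝ) + α • ((2⁻¹ : ℝ) • (1 + X)) =
      cfc (fun x : ℝ => (1 - α) * x ^ (1 / 2 : ℝ) + α * (2⁻¹ * (1 + x))) X := by
  have hsa : IsSelfAdjoint X := .of_nonneg hX
  have hc : ∀ r : ℝ, ContinuousOn (fun x : ℝ => x ^ r) (spectrum ℝ X) := by
    intro r x hx
    refine (Real.continuousAt_rpow_const x r (Or.inl ?_)).continuousWithinAt
    rintro rfl
    exact spectrum.zero_notMem ℝ hX' hx
  have h1 := hc ν
  have h2 := hc (1 - ν)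
  have h3 := hc (1 / 2)
  constructor
  · rw [cfc_const_mul _ _ X (by fun_prop), cfc_add X _ _ h1 h2,
      CFC.rpow_eq_cfc_real, CFC.rpow_eq_cfc_real]
  · rw [cfc_add X _ _ (by fun_prop) (by fun_prop), cfc_const_mul _ _ X h3,
      cfc_const_mul _ _ X (by fun_prop), cfc_const_mul _ _ X (by fun_prop),
      cfc_add X _ _ (by fun_prop) (by fun_prop), cfc_const_one ℝ X, cfc_id' ℝ X,
      CFC.rpow_eq_cfc_real]

/-- Theorem 3.1 (Heinz–Heron inequality for C*-algebras): with `α = (1-2ν)²`,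
`H_ν(A,B) ≤ F_α(A,B)` for `ν ∈ [0,1]`, and the reverse holds for `ν ∈ (-1,2) \ (0,1)`. -/
theorem stmt_18 (A B : 𝒜) (hA : 0 ≤ A) (hA' : IsUnit A) (hB : 0 ≤ B) (hB' : IsUnit B)
    (ν α : ℝ) (hα : α = (1 - 2 * ν) ^ 2) :
    (ν ∈ Set.Icc (0 : ℝ) 1 →
      (2⁻¹ : ℝ) • (sharp A B ν + sharp A B (1 - ν)) ≤
        (1 - α) • sharp A B (1 / 2 : ℝ) + α • ((2⁻¹ : ℝ) • (A + B))) ∧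
    (ν ∉ Set.Ioo (0 : ℝ) 1 → ν ∈ Set.Ioo (-1 : ℝ) 2 →
      (1 - α) • sharp A B (1 / 2 : ℝ) + α • ((2⁻¹ : ℝ) • (A + B)) ≤
        (2⁻¹ : ℝ) • (sharp A B ν + sharp A B (1 - ν))) := by
  subst hα
  have hAp : IsStrictlyPositive A := hA'.isStrictlyPositive hA
  set P : 𝒜 := A ^ (1 / 2 : ℝ) with hP
  set Q : 𝒜 := A ^ (-(1 / 2) : ℝ) with hQ
  have hPQ : P * Q = 1 := CFC.rpow_mul_rpow_neg (1 / 2) hAp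
  have hQP : Q * P = 1 := CFC.rpow_neg_mul_rpow (1 / 2) hAp
  have hPP : P * P = A := by
    rw [hP, ← CFC.rpow_add hA']
    norm_num
    exact CFC.rpow_one A hA
  have hPs : IsSelfAdjoint P := .of_nonneg CFC.rpow_nonneg
  have hQs : IsSelfAdjoint Q := .of_nonneg CFC.rpow_nonneg
  set X : 𝒜 := Q * B * Q with hXdef
  have hX : 0 ≤ X := by
    have := star_left_conjugate_nonneg hB Q
    rwa [hQs.star_eq] at this
  have hQu : IsUnit Q := ⟨⟨Q, P, hQP, hPQ⟩, rfl⟩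
  have hX' : IsUnit X := (hQu.mul hB').mul hQu
  have hB2 : P * X * P = B := by
    calc P * X * P = (P * Q) * B * (Q * P) := by rw [hXdef]; noncomm_ring
      _ = B := by rw [hPQ, hQP]; simp
  have hsharp : ∀ r : ℝ, sharp A B r = P * X ^ r * P := fun r => rfl
  obtain ⟨e1, e2⟩ := aux_cfc X hX hX' ν ((1 - 2 * ν) ^ 2)
  have hL : (2⁻¹ : ℝ) • (sharp A B ν + sharp A B (1 - ν)) =
      P * ((2⁻¹ : ℝ) • (X ^ ν + X ^ (1 - ν))) * P := by
    rw [hsharp, hsharp]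
    simp only [mul_add, add_mul, smul_add, mul_smul_comm, smul_mul_assoc]
  have hR : (1 - (1 - 2 * ν) ^ 2) • sharp A B (1 / 2 : ℝ)
        + ((1 - 2 * ν) ^ 2) • ((2⁻¹ : ℝ) • (A + B)) =
      P * ((1 - (1 - 2 * ν) ^ 2) • X ^ (1 / 2 : ℝ)
        + ((1 - 2 * ν) ^ 2) • ((2⁻¹ : ℝ) • (1 + X))) * P := by
    rw [hsharp]
    simp only [mul_add, add_mul, smul_add, mul_smul_comm, smul_mul_assoc, mul_one, hPP, hB2]
  have hc : ∀ r : ℝ, ContinuousOn (fun x : ℝ => x ^ r) (spectrum ℝ X) := by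
    intro r x hx
    refine (Real.continuousAt_rpow_const x r (Or.inl ?_)).continuousWithinAt
    rintro rfl
    exact spectrum.zero_notMem ℝ hX' hx
  have h1 := hc ν
  have h2 := hc (1 - ν)
  have h3 := hc (1 / 2)
  have hpos : ∀ x ∈ spectrum ℝ X, 0 < x := by
    intro x hx
    refine lt_of_le_of_ne (spectrum_nonneg_of_nonneg hX hx) ?_
    rintro rfl
    exact spectrum.zero_notMem ℝ hX' hx
  have hconj : ∀ Y Z : 𝒜, Y ≤ Z → P * Y * P ≤ P * Z * P := by
    intro Y Z h
    have := star_left_conjugate_le_conjugate h P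
    rwa [hPs.star_eq] at this
  rw [hL, hR, e1, e2]
  refine ⟨fun hν => hconj _ _ ?_, fun hν _ => hconj _ _ ?_⟩
  · exact cfc_mono (fun x hx => aux_le (hpos x hx) hν) (by fun_prop) (by fun_prop)
  · exact cfc_mono (fun x hx => aux_ge (hpos x hx) hν) (by fun_prop) (by fun_prop)
end

section
/- Let 𝒜 be a unital C*-algebra, let A and B be positive invertible elements of 𝒜, and let β, γ be real numbers with 1/3 ≤ β ≤ 1 ≤ γ < 2. Then ∫₀¹ (A♯_t B) dt ≤ (1-β)·(A♯_{1/2} B) + β·(A+B)/2 ≤ (A♯_γ B + A♯_{1-γ} B)/2, where the integral is a Bochner integral over (0,1). -/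
open scoped NNReal

variable {𝒜 : Type*} [CStarAlgebra 𝒜] [PartialOrder 𝒜] [StarOrderedRing 𝒜]

lemma h_deriv (s : ℝ) (hs : 0 < s) :
    HasDerivAt (fun s : ℝ => Real.log s - 3 * (s ^ 2 - 1) / (s ^ 2 + 4 * s + 1))
      ((s - 1) ^ 4 / (s * (s ^ 2 + 4 * s + 1) ^ 2)) s := by
  have hp : s ^ 2 + 4 * s + 1 ≠ 0 := by positivity
  have h1 : HasDerivAt (fun s : ℝ => 3 * (s ^ 2 - 1)) (3 * (2 * s)) s := by
    simpa using (((hasDerivAt_id s).pow 2).sub_const 1).const_mul 3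
  have h2 : HasDerivAt (fun s : ℝ => s ^ 2 + 4 * s + 1) (2 * s + 4) s := by
    simpa using (((hasDerivAt_id s).pow 2).add ((hasDerivAt_id s).const_mul 4)).add_const 1
  have h := (Real.hasDerivAt_log hs.ne').sub (h1.div h2 hp)
  refine h.congr_deriv ?_
  field_simp
  ring

lemma h_mono : MonotoneOn (fun s : ℝ => Real.log s - 3 * (s ^ 2 - 1) / (s ^ 2 + 4 * s + 1))
    (Set.Ioi 0) := by
  refine monotoneOn_of_hasDerivWithinAt_nonneg (convex_Ioi 0)
    (fun x hx => (h_deriv x hx).continuousAt.continuousWithinAt)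
    (fun x hx => (h_deriv x (interior_subset hx)).hasDerivWithinAt) ?_
  intro x hx
  have : 0 < x := interior_subset hx
  positivity

lemma log_mean_le (s : ℝ) (hs : 0 < s) :
    (if s = 1 then 1 else (s ^ 2 - 1) / (2 * Real.log s)) ≤ (2 / 3) * s + (s ^ 2 + 1) / 6 := by
  split_ifs with h
  · subst h; norm_num
  have hp : 0 < s ^ 2 + 4 * s + 1 := by positivity
  have e : (2 / 3) * s + (s ^ 2 + 1) / 6 = (s ^ 2 + 4 * s + 1) / 6 := by ring
  rw [e]
  rcases lt_or_gt_of_ne h with h | h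
  · have := h_mono (Set.mem_Ioi.2 hs) (Set.mem_Ioi.2 one_pos) h.le
    simp only [Real.log_one] at this
    norm_num at this
    have hl := Real.log_neg hs h
    rw [div_le_iff_of_neg (by linarith)]
    rw [le_div_iff₀ hp] at this
    linarith
  · have := h_mono (Set.mem_Ioi.2 one_pos) (Set.mem_Ioi.2 hs) h.le
    simp only [Real.log_one] at this
    norm_num at this
    have hl := Real.log_pos h
    rw [div_le_iff₀ (by linarith)]
    rw [div_le_iff₀ hp] at this
    linarith

lemma int_rpow (x : ℝ) (hx : 0 < x) (h1 : x ≠ 1) :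
    ∫ t in Set.Ioo (0 : ℝ) 1, x ^ t = (x - 1) / Real.log x := by
  have hl : Real.log x ≠ 0 := Real.log_ne_zero_of_pos_of_ne_one hx h1
  rw [← MeasureTheory.integral_Ioc_eq_integral_Ioo,
    ← intervalIntegral.integral_of_le zero_le_one]
  have : ∀ t : ℝ, x ^ t = Real.exp (Real.log x * t) := fun t => Real.rpow_def_of_pos hx t
  simp_rw [this]
  rw [intervalIntegral.integral_comp_mul_left (fun t => Real.exp t) hl, integral_exp]
  simp [Real.exp_log hx]
  field_simp

lemma scalar_log (x β : ℝ) (hx : 0 < x) (hβ : 1 / 3 ≤ β) :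
    ∫ t in Set.Ioo (0 : ℝ) 1, x ^ t ≤
      (1 - β) * x ^ (1 / 2 : ℝ) + β * (2⁻¹ * (1 + x)) := by
  rw [← Real.sqrt_eq_rpow]
  have hs := Real.sqrt_pos.2 hx
  have hsq := Real.sq_sqrt hx.le
  set s := Real.sqrt x
  have hi : ∫ t in Set.Ioo (0 : ℝ) 1, x ^ t =
      if s = 1 then 1 else (s ^ 2 - 1) / (2 * Real.log s) := by
    split_ifs with h
    · have : x = 1 := by rw [← hsq, h]; norm_num
      simp [this]
    · rw [int_rpow x hx (by intro h'; apply h; simp [s, h']), ← hsq, Real.log_pow]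
      norm_num
  have := log_mean_le s hs
  rw [hi]
  rw [← hsq]
  nlinarith [mul_nonneg (sub_nonneg.2 hβ) (sq_nonneg (s - 1))]

lemma scalar_heinz (x β γ : ℝ) (hx : 0 < x) (hβ2 : β ≤ 1) (hγ : 1 ≤ γ) :
    (1 - β) * x ^ (1 / 2 : ℝ) + β * (2⁻¹ * (1 + x)) ≤ 2⁻¹ * (x ^ γ + x ^ (1 - γ)) := by
  have key : 1 + x ≤ x ^ γ + x ^ (1 - γ) := by
    have e1 : x ^ γ = x ^ (γ - 1) * x := by
      rw [← Real.rpow_add_one hx.ne']; ring_nf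
    have e2 : x ^ (γ - 1) * x ^ (1 - γ) = 1 := by
      rw [← Real.rpow_add hx]; simp
    have : 0 ≤ (x ^ (γ - 1) - 1) * (x - x ^ (1 - γ)) := by
      rcases le_total 1 x with h | h
      · have h1 := Real.one_le_rpow h (sub_nonneg.2 hγ)
        have h2 := Real.rpow_le_one_of_one_le_of_nonpos h (sub_nonpos.2 hγ)
        exact mul_nonneg (by linarith) (by linarith)
      · have h1 := Real.rpow_le_one hx.le h (sub_nonneg.2 hγ)
        have h2 := Real.one_le_rpow_of_pos_of_le_one_of_nonpos hx h (sub_nonpos.2 hγ)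
        exact mul_nonneg_of_nonpos_of_nonpos (by linarith) (by linarith)
    nlinarith
  rw [← Real.sqrt_eq_rpow]
  have hsq := Real.sq_sqrt hx.le
  have : √x ≤ 2⁻¹ * (1 + x) := by nlinarith [sq_nonneg (√x - 1)]
  nlinarith [mul_le_mul_of_nonneg_left this (sub_nonneg.2 hβ2)]

lemma rpow_bound (x M t : ℝ) (hx : 0 < x) (hM : x ≤ M) (ht : t ∈ Set.Ioo (0 : ℝ) 1) :
    ‖x ^ t‖ ≤ 1 + M := by
  rw [Real.norm_of_nonneg (Real.rpow_nonneg hx.le t)]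
  rcases le_total x 1 with h | h
  · linarith [Real.rpow_le_one hx.le h ht.1.le]
  · have := Real.rpow_le_rpow_of_exponent_le h ht.2.le
    rw [Real.rpow_one] at this
    linarith

lemma int_cont (S : Set ℝ) (M : ℝ) (hS : ∀ x ∈ S, 0 < x ∧ x ≤ M) :
    ContinuousOn (fun x : ℝ => ∫ t in Set.Ioo (0 : ℝ) 1, x ^ t) S := by
  refine MeasureTheory.continuousOn_of_dominated (bound := fun _ => 1 + M) ?_ ?_ ?_ ?_
  · intro x hx
    exact (Real.continuous_const_rpow (hS x hx).1.ne').aestronglyMeasurable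
  · intro x hx
    refine MeasureTheory.ae_restrict_of_forall_mem measurableSet_Ioo ?_
    intro t ht
    exact rpow_bound x M t (hS x hx).1 (hS x hx).2 ht
  · exact MeasureTheory.integrable_const _
  · refine Filter.Eventually.of_forall ?_
    intro t x hx
    exact (Real.continuousAt_rpow_const x t (Or.inl (hS x hx).1.ne')).continuousWithinAt

lemma rpow_cont (S : Set ℝ) (hS : ∀ x ∈ S, 0 < x) (r : ℝ) :
    ContinuousOn (fun x : ℝ => x ^ r) S := fun x hx =>
  (Real.continuousAt_rpow_const x r (Or.inl (hS x hx).ne')).continuousWithinAt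

lemma op_ineq (C : 𝒜) (hC : IsStrictlyPositive C) (β γ : ℝ) (hβ1 : 1 / 3 ≤ β) (hβ2 : β ≤ 1)
    (hγ1 : 1 ≤ γ) :
    MeasureTheory.IntegrableOn (fun t : ℝ => C ^ t) (Set.Ioo (0 : ℝ) 1) ∧
    (∫ t in Set.Ioo (0 : ℝ) 1, C ^ t) ≤
      (1 - β) • C ^ (1 / 2 : ℝ) + β • ((2⁻¹ : ℝ) • (1 + C)) ∧
    (1 - β) • C ^ (1 / 2 : ℝ) + β • ((2⁻¹ : ℝ) • (1 + C)) ≤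
      (2⁻¹ : ℝ) • (C ^ γ + C ^ (1 - γ)) := by
  have hC0 : 0 ≤ C := hC.nonneg
  have hsa : IsSelfAdjoint C := IsSelfAdjoint.of_nonneg hC0
  rcases subsingleton_or_nontrivial 𝒜 with hs | hn
  · refine ⟨?_, (Subsingleton.elim _ _).le, (Subsingleton.elim _ _).le⟩
    have : (fun t : ℝ => C ^ t) = fun _ => 0 := funext fun _ => Subsingleton.elim _ _
    rw [this]
    exact MeasureTheory.integrableOn_zero
  have hpos : ∀ x ∈ spectrum ℝ C, 0 < x ∧ x ≤ ‖C‖ := fun x hx =>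
    ⟨hC.spectrum_pos hx, (le_abs_self x).trans (spectrum.norm_le_norm_of_mem hx)⟩
  have hp : ∀ x ∈ spectrum ℝ C, 0 < x := fun x hx => (hpos x hx).1
  have hpow : ∀ r : ℝ, C ^ r = cfc (fun x : ℝ => x ^ r) C := fun r => CFC.rpow_eq_cfc_real
  have hc := rpow_cont (spectrum ℝ C) hp
  have hunc : ContinuousOn (Function.uncurry (fun t x : ℝ => x ^ t))
      (Set.Ioo (0 : ℝ) 1 ×ˢ spectrum ℝ C) := by
    rintro ⟨t, x⟩ hx
    have : ContinuousAt (fun p : ℝ × ℝ => p.2 ^ p.1) (t, x) :=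
      continuousAt_snd.rpow continuousAt_fst (Or.inl (hp x hx.2).ne')
    exact this.continuousWithinAt
  have hbd : ∀ᵐ t ∂(MeasureTheory.volume.restrict (Set.Ioo (0 : ℝ) 1)),
      ∀ z ∈ spectrum ℝ C, ‖z ^ t‖ ≤ 1 + ‖C‖ :=
    MeasureTheory.ae_restrict_of_forall_mem measurableSet_Ioo fun t ht z hz =>
      rpow_bound z _ t (hp z hz) (hpos z hz).2 ht
  have hfin : MeasureTheory.HasFiniteIntegral (fun _ : ℝ => 1 + ‖C‖)
      (MeasureTheory.volume.restrict (Set.Ioo (0 : ℝ) 1)) :=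
    (MeasureTheory.integrable_const _).hasFiniteIntegral
  have hmid : (1 - β) • C ^ (1 / 2 : ℝ) + β • ((2⁻¹ : ℝ) • (1 + C)) =
      cfc (fun x : ℝ => (1 - β) * x ^ (1 / 2 : ℝ) + β * (2⁻¹ * (1 + x))) C := by
    have h1 := hc (1 / 2)
    rw [cfc_add C (fun x : ℝ => (1 - β) * x ^ (1 / 2 : ℝ)) (fun x : ℝ => β * (2⁻¹ * (1 + x)))
      (by fun_prop) (by fun_prop),
      cfc_const_mul _ _ C h1, cfc_const_mul β (fun x : ℝ => 2⁻¹ * (1 + x)) C (by fun_prop),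
      cfc_const_mul (2⁻¹ : ℝ) (fun x : ℝ => 1 + x) C (by fun_prop),
      cfc_const_add (1 : ℝ) (fun x : ℝ => x) C (by fun_prop), cfc_id' ℝ C, hpow, map_one]
  have hcm : ContinuousOn (fun x : ℝ => (1 - β) * x ^ (1 / 2 : ℝ) + β * (2⁻¹ * (1 + x)))
      (spectrum ℝ C) := by
    have h1 := hc (1 / 2)
    fun_prop
  have hr : (2⁻¹ : ℝ) • (C ^ γ + C ^ (1 - γ)) =
      cfc (fun x : ℝ => 2⁻¹ * (x ^ γ + x ^ (1 - γ))) C := by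
    rw [cfc_const_mul (2⁻¹ : ℝ) (fun x : ℝ => x ^ γ + x ^ (1 - γ)) C ((hc γ).add (hc (1 - γ))),
      cfc_add C (fun x : ℝ => x ^ γ) (fun x : ℝ => x ^ (1 - γ)) (hc γ) (hc (1 - γ)),
      hpow, hpow]
  refine ⟨?_, ?_, ?_⟩
  · simp_rw [hpow]
    exact integrableOn_cfc measurableSet_Ioo (fun t x : ℝ => x ^ t) (fun _ => 1 + ‖C‖) C
      hunc hbd hfin hsa
  · have : (∫ t in Set.Ioo (0 : ℝ) 1, C ^ t) =
        cfc (fun x : ℝ => ∫ t in Set.Ioo (0 : ℝ) 1, x ^ t) C := by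
      simp_rw [hpow]
      exact (cfc_setIntegral measurableSet_Ioo (fun t x : ℝ => x ^ t) (fun _ => 1 + ‖C‖) C
        hunc hbd hfin hsa).symm
    rw [this, hmid]
    exact cfc_mono (fun x hx => scalar_log x β (hp x hx) hβ1)
      (int_cont _ _ hpos) hcm
  · rw [hmid, hr]
    exact cfc_mono (fun x hx => scalar_heinz x β γ (hp x hx) hβ2 hγ1) hcm
      (((hc γ).add (hc (1 - γ))).const_mul _)


/-- Inequality (2.5): `L(A,B) ≤ F_β(A,B) ≤ H_γ(A,B)` for `1/3 ≤ β ≤ 1 ≤ γ < 2`,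
where `L` is the logarithmic mean, `F` the Heron mean and `H` the Heinz mean. -/
theorem stmt_19 (A B : 𝒜) (hA : 0 ≤ A) (hA' : IsUnit A) (hB : 0 ≤ B) (hB' : IsUnit B)
    (β γ : ℝ) (hβ1 : 1 / 3 ≤ β) (hβ2 : β ≤ 1) (hγ1 : 1 ≤ γ) (hγ2 : γ < 2) :
    (∫ t in Set.Ioo (0 : ℝ) 1, sharp A B t) ≤
        (1 - β) • sharp A B (1 / 2 : ℝ) + β • ((2⁻¹ : ℝ) • (A + B)) ∧
      (1 - β) • sharp A B (1 / 2 : ℝ) + β • ((2⁻¹ : ℝ) • (A + B)) ≤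
        (2⁻¹ : ℝ) • (sharp A B γ + sharp A B (1 - γ)) := by
  have hAs : IsStrictlyPositive A := IsStrictlyPositive.iff_of_unital.2 ⟨hA, hA'⟩
  have hBs : IsStrictlyPositive B := IsStrictlyPositive.iff_of_unital.2 ⟨hB, hB'⟩
  obtain ⟨P, hP⟩ : ∃ P : 𝒜, P = A ^ (1 / 2 : ℝ) := ⟨_, rfl⟩
  obtain ⟨Q, hQ⟩ : ∃ Q : 𝒜, Q = A ^ (-(1 / 2) : ℝ) := ⟨_, rfl⟩
  have hPQ : P * Q = 1 := by rw [hP, hQ]; exact CFC.rpow_mul_rpow_neg _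
  have hQP : Q * P = 1 := by rw [hP, hQ]; exact CFC.rpow_neg_mul_rpow _
  have hPP : P * P = A := by
    rw [hP, ← CFC.rpow_add hA']
    norm_num
    exact CFC.rpow_one A
  have hP0 : 0 ≤ P := by rw [hP]; exact CFC.rpow_nonneg
  have hQ0 : 0 ≤ Q := by rw [hQ]; exact CFC.rpow_nonneg
  have hQu : IsUnit Q := ⟨⟨Q, P, hQP, hPQ⟩, rfl⟩
  have hC : IsStrictlyPositive (Q * B * Q) :=
    IsStrictlyPositive.iff_of_unital.2
      ⟨conjugate_nonneg_of_nonneg hB hQ0, (hQu.mul hB').mul hQu⟩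
  have hsharp : ∀ r : ℝ, sharp A B r = P * (Q * B * Q) ^ r * P := by
    intro r; rw [hP, hQ]; rfl
  have hAB : A + B = P * (1 + Q * B * Q) * P := by
    have : P * (1 + Q * B * Q) * P = P * P + (P * Q) * B * (Q * P) := by noncomm_ring
    rw [this, hPQ, hQP, hPP]; simp
  obtain ⟨hint, h1, h2⟩ := op_ineq (Q * B * Q) hC β γ hβ1 hβ2 hγ1
  have hmid : (1 - β) • sharp A B (1 / 2 : ℝ) + β • ((2⁻¹ : ℝ) • (A + B)) =
      P * ((1 - β) • (Q * B * Q) ^ (1 / 2 : ℝ) + β • ((2⁻¹ : ℝ) • (1 + Q * B * Q))) * P := by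
    rw [hsharp, hAB, mul_add P (_ • _), add_mul (P * _), mul_smul_comm, mul_smul_comm,
      mul_smul_comm, smul_mul_assoc, smul_mul_assoc, smul_mul_assoc]
  rw [hmid]
  constructor
  · have : (∫ t in Set.Ioo (0 : ℝ) 1, sharp A B t) =
        P * (∫ t in Set.Ioo (0 : ℝ) 1, (Q * B * Q) ^ t) * P := by
      simp_rw [hsharp]
      have := ContinuousLinearMap.integral_comp_comm
        (((ContinuousLinearMap.mul ℝ 𝒜).flip P).comp (ContinuousLinearMap.mul ℝ 𝒜 P)) hint
      simpa using this
    rw [this]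
    exact conjugate_le_conjugate_of_nonneg h1 hP0
  · have : (2⁻¹ : ℝ) • (sharp A B γ + sharp A B (1 - γ)) =
        P * ((2⁻¹ : ℝ) • ((Q * B * Q) ^ γ + (Q * B * Q) ^ (1 - γ))) * P := by
      rw [hsharp, hsharp, mul_smul_comm, smul_mul_assoc, mul_add, add_mul]
    rw [this]
    exact conjugate_le_conjugate_of_nonneg h2 hP0
end
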